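/- arXiv:1712.05495 — 6 statements merged into one kernel-verified Lean document; each statement's English description precedes it below -/
import Mathlib

section
/- There exist a universal integer p₀ and a universal constant c > 0 such that for every p ≥ p₀ and every s ≤ n/61, the group hard thresholding estimator satisfies the lower bound inf_{λ>0} sup_{Θ ∈ M(p,n,s)} E_Θ‖L̂^GHT_λ − L(Θ)‖₂² ≥ c σ² ( (s² p^{1/2}) ∧ (np) + s² log(1+n/s²) + s p ), where the infimum is over all choices of the threshold λ > 0. -/
open MeasureTheory ProbabilityTheory Real

noncomputable section

/-- Squared Euclidean norm on `ℝ^p`. -/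
def sqnorm {p : ℕ} (v : Fin p → ℝ) : ℝ := ∑ i, (v i) ^ 2

/-- The law of a `p × n` matrix (given by its `n` columns) with i.i.d. `N(0,1)` entries. -/
def noiseMeasure (p n : ℕ) : Measure (Fin n → Fin p → ℝ) :=
  Measure.pi fun _ => Measure.pi fun _ => gaussianReal 0 1

/-- `M(p,n,s)`: matrices (given by their columns) with at most `s` nonzero columns. -/
def ColSparse (p n s : ℕ) : Set (Fin n → Fin p → ℝ) :=
  {Θ | ∃ S : Finset (Fin n), S.card ≤ s ∧ ∀ j ∉ S, Θ j = 0}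

/-- The linear functional `L(Θ) = Θ 1_n`, i.e. the sum of all columns. -/
def Lfun {p n : ℕ} (Θ : Fin n → Fin p → ℝ) : Fin p → ℝ := ∑ j, Θ j

/-- The group hard thresholding estimator of `L(Θ)` with threshold `lam`:
`L̂ = ∑_i Y_i 1{‖Y_i‖₂ ≥ lam}`. -/
def ghtEst {p n : ℕ} (lam : ℝ) (Y : Fin n → Fin p → ℝ) : Fin p → ℝ :=
  ∑ j, if lam ≤ Real.sqrt (sqnorm (Y j)) then Y j else 0

/-- The standard Gaussian measure on `ℝ^p`. -/
abbrev stdGaussianPi (p : ℕ) : Measure (Fin p → ℝ) := Measure.pi fun _ => gaussianReal 0 1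

lemma integral_exp_mul_sq_sub_one {t : ℝ} (ht : t < 1 / 2) :
    ∫ x, exp (t * (x ^ 2 - 1)) ∂(gaussianReal 0 1) = exp (-t) * (√(1 - 2 * t))⁻¹ := by
  rw [integral_gaussianReal_eq_integral_smul (by simp)]
  have h (x : ℝ) : gaussianPDFReal 0 1 x • exp (t * (x ^ 2 - 1)) =
      (exp (-t) * (√(2 * π))⁻¹) * exp (-(1 / 2 - t) * x ^ 2) := by
    simp only [gaussianPDFReal, NNReal.coe_one, mul_one, sub_zero, smul_eq_mul]
    rw [mul_assoc, ← exp_add, mul_comm (exp (-t)), mul_assoc, ← exp_add]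
    ring_nf
  simp_rw [h]
  rw [integral_const_mul, integral_gaussian, mul_assoc]
  congr 1
  have h1 : π / (1 / 2 - t) = (2 * π) * (1 - 2 * t)⁻¹ := by
    have : (1 / 2 - t) ≠ 0 := by linarith
    have : (1 - 2 * t) ≠ 0 := by linarith
    field_simp
  rw [h1, sqrt_mul (by positivity : (0 : ℝ) ≤ 2 * π), sqrt_inv, ← mul_assoc, inv_mul_cancel₀ (by positivity), one_mul]

lemma integrable_exp_mul_sq_sub_one {t : ℝ} (ht : t < 1 / 2) :
    Integrable (fun x => exp (t * (x ^ 2 - 1))) (gaussianReal 0 1) := by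
  apply Integrable.of_integral_ne_zero
  rw [integral_exp_mul_sq_sub_one ht]
  have : 0 < √(1 - 2 * t) := sqrt_pos.2 (by linarith)
  positivity

lemma exp_sq_le_integral_exp_mul_sq_sub_one {t : ℝ} (h0 : 0 ≤ t) (ht : t ≤ 1 / 4) :
    exp (t ^ 2) ≤ ∫ x, exp (t * (x ^ 2 - 1)) ∂(gaussianReal 0 1) := by
  rw [integral_exp_mul_sq_sub_one (by linarith)]
  have hlog : log (1 - 2 * t) ≤ -(2 * t + 2 * t ^ 2) := by
    have h := hasSum_pow_div_log_of_abs_lt_one (x := 2 * t) (by rw [abs_lt]; constructor <;> linarith)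
    have := sum_le_hasSum (Finset.range 2) (fun i _ => by positivity) h
    norm_num [Finset.sum_range_succ] at this
    nlinarith
  have hs : √(1 - 2 * t) ≤ exp (-(t + t ^ 2)) := by
    rw [sqrt_le_left (exp_pos _).le, ← exp_nat_mul, ← log_le_iff_le_exp (by linarith)]
    push_cast; linarith
  have hpos : 0 < √(1 - 2 * t) := sqrt_pos.2 (by linarith)
  rw [← div_eq_mul_inv, le_div_iff₀ hpos]
  calc _ ≤ exp (t ^ 2) * exp (-(t + t ^ 2)) := by gcongr
    _ = _ := by rw [← exp_add]; ring_nf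

lemma integral_exp_mul_sq_sub_one_le {t : ℝ} (h0 : 0 ≤ t) (ht : t ≤ 1 / 4) :
    ∫ x, exp (t * (x ^ 2 - 1)) ∂(gaussianReal 0 1) ≤ exp (2 * t ^ 2) := by
  rw [integral_exp_mul_sq_sub_one (by linarith)]
  have hx : exp (-(2 * t + 4 * t ^ 2)) ≤ 1 - 2 * t := by
    have h1 := quadratic_le_exp_of_nonneg (x := 2 * t + 4 * t ^ 2) (by positivity)
    rw [exp_neg]
    apply inv_le_of_inv_le₀ (by linarith)
    refine le_trans ?_ h1
    rw [inv_le_iff_one_le_mul₀ (by linarith)]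
    have h3 : 0 ≤ t ^ 2 * (1 - 4 * t) := mul_nonneg (by positivity) (by linarith)
    have h5 : 0 ≤ t ^ 4 * (1 - 4 * t) := mul_nonneg (by positivity) (by linarith)
    nlinarith [pow_nonneg h0 2, pow_nonneg h0 3, pow_nonneg h0 4]
  have hs : exp (-(t + 2 * t ^ 2)) ≤ √(1 - 2 * t) := by
    apply le_sqrt_of_sq_le
    rw [← exp_nat_mul]
    convert! hx using 2
    push_cast; ring
  have hpos : 0 < √(1 - 2 * t) := sqrt_pos.2 (by linarith)
  rw [← div_eq_mul_inv, div_le_iff₀ hpos]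
  calc _ = exp (2 * t ^ 2) * exp (-(t + 2 * t ^ 2)) := by rw [← exp_add]; ring_nf
    _ ≤ _ := by gcongr

lemma exp_mul_sqnorm_sub_eq_prod {p : ℕ} (t : ℝ) (x : Fin p → ℝ) :
    exp (t * (sqnorm x - p)) = ∏ i, exp (t * (x i ^ 2 - 1)) := by
  rw [← exp_sum, ← Finset.mul_sum, Finset.sum_sub_distrib]
  simp [sqnorm]

lemma integrable_exp_mul_sqnorm_sub {p : ℕ} {t : ℝ} (ht : t < 1 / 2) :
    Integrable (fun x => exp (t * (sqnorm x - p))) (stdGaussianPi p) := by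
  simp_rw [exp_mul_sqnorm_sub_eq_prod]
  exact Integrable.fintype_prod fun _ => integrable_exp_mul_sq_sub_one ht

lemma exp_le_integral_exp_mul_sqnorm_sub {p : ℕ} {t : ℝ} (h0 : 0 ≤ t) (ht : t ≤ 1 / 4) :
    exp (p * t ^ 2) ≤ ∫ x, exp (t * (sqnorm x - p)) ∂(stdGaussianPi p) := by
  simp_rw [exp_mul_sqnorm_sub_eq_prod]
  rw [integral_fintype_prod_eq_pow (μ := gaussianReal 0 1) (fun y => exp (t * (y ^ 2 - 1))), exp_nat_mul,
    Fintype.card_fin]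
  gcongr
  exact exp_sq_le_integral_exp_mul_sq_sub_one h0 ht

lemma integral_exp_mul_sqnorm_sub_le {p : ℕ} {t : ℝ} (h0 : 0 ≤ t) (ht : t ≤ 1 / 4) :
    ∫ x, exp (t * (sqnorm x - p)) ∂(stdGaussianPi p) ≤ exp (p * (2 * t ^ 2)) := by
  simp_rw [exp_mul_sqnorm_sub_eq_prod]
  rw [integral_fintype_prod_eq_pow (μ := gaussianReal 0 1) (fun y => exp (t * (y ^ 2 - 1))), exp_nat_mul,
    Fintype.card_fin]
  exact pow_le_pow_left₀ (integral_nonneg fun _ => (exp_pos _).le)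
    (integral_exp_mul_sq_sub_one_le h0 ht) p

/-- A Paley–Zygmund type inequality. -/
lemma sq_div_le_measureReal_of_half_le {Ω : Type*} [MeasurableSpace Ω] {μ : Measure Ω}
    [IsProbabilityMeasure μ] {W : Ω → ℝ} {A : Set Ω} {m M : ℝ} (hm : 0 < m) (hM : 0 < M)
    (hA : MeasurableSet A) (hW : Integrable W μ) (hW2 : Integrable (fun x => W x ^ 2) μ)
    (h1 : m ≤ ∫ x, W x ∂μ) (h2 : ∫ x, W x ^ 2 ∂μ ≤ M) (hWA : ∀ x, m / 2 ≤ W x → x ∈ A) :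
    m ^ 2 / (4 * M) ≤ μ.real A := by
  have hk : 0 < m / (4 * M) := by positivity
  have hind : Integrable (A.indicator (fun _ => (1 : ℝ))) μ :=
    (integrable_const 1).indicator hA
  have hpt (x : Ω) : W x ≤ m / 2 + m / (4 * M) * W x ^ 2 + M / m * A.indicator (fun _ => 1) x := by
    by_cases hx : x ∈ A
    · simp only [Set.indicator_of_mem hx, mul_one]
      have : m / (4 * M) * W x ^ 2 + M / m - W x = m / (4 * M) * (W x - 2 * M / m) ^ 2 := by
        field_simp; ring
      nlinarith [mul_nonneg hk.le (sq_nonneg (W x - 2 * M / m))]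
    · simp only [Set.indicator_of_notMem hx, mul_zero, add_zero]
      have : W x < m / 2 := by by_contra h; exact hx (hWA x (not_lt.1 h))
      nlinarith [mul_nonneg hk.le (sq_nonneg (W x))]
  have hint := integral_mono hW
    (((integrable_const (m / 2)).add (hW2.const_mul (m / (4 * M)))).add (hind.const_mul (M / m))) hpt
  simp only [Pi.add_apply] at hint
  rw [integral_add, integral_add, integral_const_mul, integral_const_mul,
    integral_indicator_const _ hA] at hint
  · simp only [integral_const, probReal_univ, smul_eq_mul, one_mul, mul_one] at hint
    have h3 : m / (4 * M) * ∫ x, W x ^ 2 ∂μ ≤ m / 4 := by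
      calc _ ≤ m / (4 * M) * M := by gcongr
        _ = _ := by field_simp
    have h4 : m / 4 ≤ M / m * μ.real A := by linarith
    rw [div_le_iff₀ (by positivity)]
    have := mul_le_mul_of_nonneg_left h4 hm.le
    have h5 : m * (M / m * μ.real A) = M * μ.real A := by field_simp
    nlinarith
  · exact integrable_const _
  · exact hW2.const_mul _
  · exact (integrable_const (m / 2)).add (hW2.const_mul (m / (4 * M)))
  · exact hind.const_mul _

lemma measurable_sqnorm {p : ℕ} : Measurable (sqnorm : (Fin p → ℝ) → ℝ) := by
  unfold sqnorm; fun_prop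

lemma exp_le_measureReal_sqnorm_ge {p : ℕ} {t : ℝ} (h0 : 0 < t) (ht : t ≤ 1 / 8)
    (hpt : 2 ≤ p * t ^ 2) :
    exp (-(6 * (p * t ^ 2))) / 4 ≤
      (stdGaussianPi p).real {x | p + p * t / 2 ≤ sqnorm x} := by
  have hsq (x : Fin p → ℝ) : exp (t * (sqnorm x - p)) ^ 2 = exp ((2 * t) * (sqnorm x - p)) := by
    rw [← exp_nat_mul]; push_cast; ring_nf
  have := sq_div_le_measureReal_of_half_le (μ := stdGaussianPi p)
    (W := fun x => exp (t * (sqnorm x - p))) (A := {x | p + p * t / 2 ≤ sqnorm x})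
    (exp_pos (p * t ^ 2)) (exp_pos (p * (2 * (2 * t) ^ 2)))
    (measurableSet_le measurable_const measurable_sqnorm)
    (integrable_exp_mul_sqnorm_sub (by linarith))
    (by simp_rw [hsq]; exact integrable_exp_mul_sqnorm_sub (by linarith))
    (exp_le_integral_exp_mul_sqnorm_sub h0.le (by linarith))
    (by simp_rw [hsq]; exact integral_exp_mul_sqnorm_sub_le (by linarith) (by linarith))
    (by
      intro x hx
      have h2 : exp (p * t ^ 2 - 1) ≤ exp (t * (sqnorm x - p)) := by
        refine le_trans ?_ hx
        rw [exp_sub, div_le_div_iff_of_pos_left (exp_pos _) (exp_pos _) (by norm_num)]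
        linarith [add_one_le_exp (1 : ℝ)]
      rw [exp_le_exp] at h2
      change p + p * t / 2 ≤ sqnorm x
      have : t * (p * t / 2) ≤ t * (sqnorm x - p) := by nlinarith
      linarith [le_of_mul_le_mul_left this h0])
  refine le_trans (le_of_eq ?_) this
  rw [← exp_nat_mul, mul_comm 4, ← div_div, ← exp_sub]
  push_cast; ring_nf

lemma exp_le_measureReal_gaussianReal_ge {t : ℝ} (ht : 2 ≤ t) :
    exp (-t ^ 2) / 4 ≤ (gaussianReal 0 1).real {x | t / 4 ≤ x} := by
  have hI (t : ℝ) : ∫ x, exp (t * x) ∂(gaussianReal 0 1) = exp (t ^ 2 / 2) := by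
    have := congrFun (mgf_fun_id_gaussianReal (μ := 0) (v := 1)) t
    simpa [mgf] using this
  have hsq (x : ℝ) : exp (t * x) ^ 2 = exp ((2 * t) * x) := by
    rw [← exp_nat_mul]; push_cast; ring_nf
  have := sq_div_le_measureReal_of_half_le (μ := gaussianReal 0 1)
    (W := fun x => exp (t * x)) (A := {x | t / 4 ≤ x})
    (exp_pos (t ^ 2 / 2)) (exp_pos ((2 * t) ^ 2 / 2))
    (measurableSet_le measurable_const measurable_id)
    (integrable_exp_mul_gaussianReal t)
    (by simp_rw [hsq]; exact integrable_exp_mul_gaussianReal _)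
    (hI t).ge
    (by simp_rw [hsq]; exact (hI _).le)
    (by
      intro x hx
      have h2 : exp (t ^ 2 / 2 - 1) ≤ exp (t * x) := by
        refine le_trans ?_ hx
        rw [exp_sub, div_le_div_iff_of_pos_left (exp_pos _) (exp_pos _) (by norm_num)]
        linarith [add_one_le_exp (1 : ℝ)]
      rw [exp_le_exp] at h2
      change t / 4 ≤ x
      have : t * (t / 4) ≤ t * x := by nlinarith
      exact le_of_mul_le_mul_left this (by linarith))
  refine le_trans (le_of_eq ?_) this
  rw [← exp_nat_mul, mul_comm 4, ← div_div, ← exp_sub]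
  push_cast; ring_nf

lemma sq_le_sqnorm {p : ℕ} (x : Fin p → ℝ) (i : Fin p) : x i ^ 2 ≤ sqnorm x :=
  Finset.single_le_sum (f := fun i => x i ^ 2) (fun _ _ => sq_nonneg _) (Finset.mem_univ _)

lemma exp_le_measureReal_sqnorm_ge_of_sqrt_le {p : ℕ} {L : ℝ} (hp : 1 ≤ p) (hL : 500 * √p ≤ L) :
    exp (-(L / 2)) / 4 ≤ (stdGaussianPi p).real {x | p + L / 600 ≤ sqnorm x} := by
  have hp' : (1 : ℝ) ≤ p := by exact_mod_cast hp
  have hp0 : (0 : ℝ) < p := by linarith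
  have hsq : √(p : ℝ) ^ 2 = p := sq_sqrt hp0.le
  have hs1 : 1 ≤ √(p : ℝ) := one_le_sqrt.2 hp'
  have hL0 : 500 ≤ L := by linarith
  have hL2 : 250000 * p ≤ L ^ 2 := by nlinarith
  rcases le_or_gt L (37.5 * p) with h | h
  · have ht0 : 0 < L / (300 * p) := by positivity
    have ht : L / (300 * p) ≤ 1 / 8 := by
      rw [div_le_iff₀ (by positivity)]; linarith
    have hpt : p * (L / (300 * p)) = L / 300 := by field_simp
    have hpt2 : p * (L / (300 * p)) ^ 2 = L ^ 2 / (90000 * p) := by field_simp; norm_num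
    have h2 : p * (L / (300 * p)) ^ 2 ≤ L / 2400 := by
      rw [pow_two, ← mul_assoc, hpt]
      nlinarith
    have h1 := exp_le_measureReal_sqnorm_ge (p := p) ht0 ht
      (by rw [hpt2, le_div_iff₀ (by positivity)]; linarith)
    rw [hpt] at h1
    have h3 : L / 300 / 2 = L / 600 := by ring
    rw [h3] at h1
    refine le_trans ?_ h1
    gcongr
    linarith
  · have ht2 : √(0.4534 * L) ^ 2 = 0.4534 * L := sq_sqrt (by linarith)
    have h1 := exp_le_measureReal_gaussianReal_ge (t := √(0.4534 * L))
      (le_sqrt_of_sq_le (by linarith))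
    rw [ht2] at h1
    have h2 : (gaussianReal 0 1).real {x | √(0.4534 * L) / 4 ≤ x} =
        (stdGaussianPi p).real {x | √(0.4534 * L) / 4 ≤ x ⟨0, hp⟩} :=
      ((measurePreserving_eval (fun _ : Fin p => gaussianReal 0 1) ⟨0, hp⟩).measureReal_preimage
        (measurableSet_le measurable_const measurable_id).nullMeasurableSet).symm
    calc exp (-(L / 2)) / 4 ≤ exp (-(0.4534 * L)) / 4 := by gcongr; linarith
      _ ≤ _ := h1
      _ = _ := h2
      _ ≤ _ := by
        apply measureReal_mono _ (measure_ne_top _ _)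
        intro x hx
        change √(0.4534 * L) / 4 ≤ x ⟨0, hp⟩ at hx
        change p + L / 600 ≤ sqnorm x
        have h3 := sq_le_sqnorm x ⟨0, hp⟩
        have h4 : (√(0.4534 * L) / 4) ^ 2 ≤ x ⟨0, hp⟩ ^ 2 := by gcongr
        rw [div_pow, ht2] at h4
        linarith

/-- Estimation error of the hard thresholding rule on a single column. -/
def colErr {p : ℕ} (r : ℝ) (θ x : Fin p → ℝ) (i : Fin p) : ℝ :=
  (if r ≤ √(sqnorm (θ + x)) then (θ + x) i else 0) - θ i

lemma measurable_colErr {p : ℕ} (r : ℝ) (θ : Fin p → ℝ) (i : Fin p) :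
    Measurable fun x => colErr r θ x i := by
  unfold colErr
  refine Measurable.sub (Measurable.ite ?_ (by simp only [Pi.add_apply]; fun_prop)
    measurable_const) measurable_const
  exact measurableSet_le measurable_const (measurable_sqnorm.comp (by fun_prop)).sqrt

lemma memLp_eval_stdGaussianPi {p : ℕ} (i : Fin p) :
    MemLp (fun x => x i) 2 (stdGaussianPi p) :=
  (memLp_id_gaussianReal' 2 (by simp)).comp_measurePreserving
    (measurePreserving_eval (fun _ : Fin p => gaussianReal 0 1) i)

lemma integral_eval_stdGaussianPi {p : ℕ} (i : Fin p) : ∫ x, x i ∂(stdGaussianPi p) = 0 := by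
  have := integral_comp_eval (μ := fun _ : Fin p => gaussianReal 0 1) (i := i)
    (f := fun y => y) (by fun_prop)
  rw [this, integral_id_gaussianReal]

lemma integral_sq_eval_stdGaussianPi {p : ℕ} (i : Fin p) :
    ∫ x, x i ^ 2 ∂(stdGaussianPi p) = 1 := by
  have h := variance_eq_sub (memLp_id_gaussianReal' (μ := 0) (v := 1) 2 (by simp))
  rw [variance_id_gaussianReal] at h
  simp at h
  rw [integral_comp_eval (μ := fun _ : Fin p => gaussianReal 0 1) (i := i)
    (f := fun y => y ^ 2) (by fun_prop), ← h]

lemma memLp_colErr {p : ℕ} (r : ℝ) (θ : Fin p → ℝ) (i : Fin p) :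
    MemLp (fun x => colErr r θ x i) 2 (stdGaussianPi p) := by
  refine ((memLp_eval_stdGaussianPi i).norm.add (memLp_const |θ i|)).mono
    (measurable_colErr r θ i).aestronglyMeasurable (.of_forall fun x => ?_)
  simp only [colErr, Pi.add_apply, norm_eq_abs]
  rw [abs_of_nonneg (a := |x i| + |θ i|) (by positivity)]
  split_ifs
  · simp
  · simp

lemma integral_sq_sum_pi {ι : Type*} [Fintype ι] {Ω : ι → Type*} {mΩ : ∀ i, MeasurableSpace (Ω i)}
    {μ : (i : ι) → Measure (Ω i)} [∀ i, IsProbabilityMeasure (μ i)]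
    {X : Π i, Ω i → ℝ} (h : ∀ i, MemLp (X i) 2 (μ i)) :
    ∫ ω, (∑ i, X i (ω i)) ^ 2 ∂(Measure.pi μ) =
      ∑ i, Var[X i; μ i] + (∑ i, ∫ x, X i x ∂(μ i)) ^ 2 := by
  have hX (i : ι) : MemLp (fun ω : (Π i, Ω i) => X i (ω i)) 2 (Measure.pi μ) :=
    (h i).comp_measurePreserving (measurePreserving_eval μ i)
  have hS : MemLp (∑ i, fun ω : (Π i, Ω i) => X i (ω i)) 2 (Measure.pi μ) :=
    memLp_finsetSum' _ fun i _ => hX i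
  have h1 := variance_eq_sub hS
  rw [variance_sum_pi h] at h1
  have h2 : (∫ ω, (∑ i, fun ω : (Π i, Ω i) => X i (ω i)) ω ∂(Measure.pi μ)) =
      ∑ i, ∫ x, X i x ∂(μ i) := by
    simp only [Finset.sum_apply]
    rw [integral_finsetSum _ fun i _ => (hX i).integrable (by norm_num)]
    exact Finset.sum_congr rfl fun i _ => integral_comp_eval (h i).1
  rw [h2] at h1
  simp only [Pi.pow_apply, Finset.sum_apply] at h1
  linarith

lemma lintegral_sqnorm_sum_colErr {p n : ℕ} (r : ℝ) (Θ : Fin n → Fin p → ℝ) :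
    ∫⁻ ξ, ENNReal.ofReal (sqnorm fun i => ∑ j, colErr r (Θ j) (ξ j) i) ∂(noiseMeasure p n) =
      ENNReal.ofReal (∑ i, (∑ j, Var[fun x => colErr r (Θ j) x i; stdGaussianPi p] +
        (∑ j, ∫ x, colErr r (Θ j) x i ∂(stdGaussianPi p)) ^ 2)) := by
  have hI (i : Fin p) : Integrable (fun ξ : Fin n → Fin p → ℝ =>
      (∑ j, colErr r (Θ j) (ξ j) i) ^ 2) (noiseMeasure p n) := by
    apply MemLp.integrable_sq
    exact memLp_finsetSum _ fun j _ => (memLp_colErr r (Θ j) i).comp_measurePreserving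
      (measurePreserving_eval (fun _ : Fin n => stdGaussianPi p) j)
  rw [← ofReal_integral_eq_lintegral_ofReal]
  · congr 1
    simp only [sqnorm]
    rw [integral_finsetSum _ fun i _ => hI i]
    exact Finset.sum_congr rfl fun i _ => integral_sq_sum_pi
      (μ := fun _ : Fin n => stdGaussianPi p) (X := fun j x => colErr r (Θ j) x i)
      fun j => memLp_colErr r (Θ j) i
  · exact integrable_finsetSum _ fun i _ => hI i
  · exact .of_forall fun _ => Finset.sum_nonneg fun _ _ => sq_nonneg _

lemma sqnorm_smul {p : ℕ} (a : ℝ) (v : Fin p → ℝ) : sqnorm (a • v) = a ^ 2 * sqnorm v := by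
  simp [sqnorm, mul_pow, Finset.mul_sum]

lemma ghtEst_sub_Lfun_smul {p n : ℕ} {σ lam : ℝ} (hσ : 0 < σ) (Θ ξ : Fin n → Fin p → ℝ) :
    ghtEst lam (fun j => (σ • Θ) j + σ • ξ j) - Lfun (σ • Θ) =
      σ • fun i => ∑ j, colErr (lam / σ) (Θ j) (ξ j) i := by
  ext i
  simp only [ghtEst, Lfun, Pi.sub_apply, Finset.sum_apply, ← Finset.sum_sub_distrib, Pi.smul_apply,
    smul_eq_mul, Finset.mul_sum, colErr]
  refine Finset.sum_congr rfl fun j _ => ?_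
  rw [← smul_add, sqnorm_smul, sqrt_mul (sq_nonneg σ), sqrt_sq hσ.le]
  have hiff := div_le_iff₀' hσ (a := √(sqnorm (Θ j + ξ j))) (b := lam)
  by_cases h : lam ≤ σ * √(sqnorm (Θ j + ξ j))
  · simp only [h, hiff.2 h, if_true, Pi.smul_apply, smul_eq_mul]; ring
  · simp only [h, mt hiff.1 h, if_false, Pi.zero_apply]; ring

/-- The (unit noise level) quadratic risk of hard thresholding. -/
def ghtRisk {p n : ℕ} (r : ℝ) (Θ : Fin n → Fin p → ℝ) : ℝ :=
  ∑ i, (∑ j, Var[fun x => colErr r (Θ j) x i; stdGaussianPi p] +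
        (∑ j, ∫ x, colErr r (Θ j) x i ∂(stdGaussianPi p)) ^ 2)

lemma lintegral_sqnorm_ghtEst {p n : ℕ} {σ lam : ℝ} (hσ : 0 < σ) (Θ : Fin n → Fin p → ℝ) :
    ∫⁻ ξ, ENNReal.ofReal (sqnorm (ghtEst lam (fun j => (σ • Θ) j + σ • ξ j) - Lfun (σ • Θ)))
        ∂(noiseMeasure p n) = ENNReal.ofReal (σ ^ 2 * ghtRisk (lam / σ) Θ) := by
  simp_rw [ghtEst_sub_Lfun_smul hσ, sqnorm_smul]
  simp_rw [ENNReal.ofReal_mul (sq_nonneg σ)]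
  rw [lintegral_const_mul' _ _ ENNReal.ofReal_ne_top, lintegral_sqnorm_sum_colErr]
  rfl

lemma integrable_sq_eval_stdGaussianPi {p : ℕ} (i : Fin p) :
    Integrable (fun x => x i ^ 2) (stdGaussianPi p) :=
  (memLp_eval_stdGaussianPi i).integrable_sq

lemma variance_colErr_ge {p : ℕ} {r : ℝ} (hr : 0 < r) {θ : Fin p → ℝ} {i₀ : Fin p}
    (hθ : θ i₀ = 3 * r) (i : Fin p) :
    1 / 4 ≤ Var[fun x => colErr r θ x i; stdGaussianPi p] := by
  have hX := memLp_colErr r θ i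
  have hξ := memLp_eval_stdGaussianPi i
  have hpt (x : Fin p → ℝ) : (colErr r θ x i - 1 / 2 * x i) ^ 2 ≤
      colErr r θ x i ^ 2 + (1 / 4 * x i₀ ^ 2 - 1 / 2 * x i ^ 2) := by
    unfold colErr
    split_ifs with h
    · simp only [Pi.add_apply]
      nlinarith [sq_nonneg (x i₀), sq_nonneg (x i)]
    · have hlt : sqnorm (θ + x) < r ^ 2 := by
        rw [not_le, sqrt_lt' hr] at h; exact h
      have hi : |θ i + x i| < r := by
        apply abs_lt_of_sq_lt_sq _ hr.le
        exact (sq_le_sqnorm (θ + x) i).trans_lt hlt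
      have hi0 : |θ i₀ + x i₀| < r := by
        apply abs_lt_of_sq_lt_sq _ hr.le
        exact (sq_le_sqnorm (θ + x) i₀).trans_lt hlt
      have hx0 : 2 * r ≤ |x i₀| := by
        rw [hθ, abs_lt] at hi0
        rw [le_abs]; right; linarith
      have h1 : (θ i + x i) * x i ≤ |x i₀| / 2 * |x i| := by
        refine (le_abs_self _).trans ?_
        rw [abs_mul]
        gcongr
        linarith
      have h2 : |x i₀| / 2 * |x i| ≤ (|x i₀| ^ 2 + |x i| ^ 2) / 4 := by
        nlinarith [sq_nonneg (|x i₀| - |x i|)]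
      rw [sq_abs, sq_abs] at h2
      nlinarith
  have h1 := variance_nonneg (fun x => colErr r θ x i - 1 / 2 * x i) (stdGaussianPi p)
  have hY : MemLp (fun x => colErr r θ x i - 1 / 2 * x i) 2 (stdGaussianPi p) :=
    hX.sub (hξ.const_mul (1 / 2))
  have hIX := hX.integrable_sq
  have hI2 : Integrable (fun x => 1 / 4 * x i₀ ^ 2 - 1 / 2 * x i ^ 2) (stdGaussianPi p) :=
    ((integrable_sq_eval_stdGaussianPi i₀).const_mul _).sub
      ((integrable_sq_eval_stdGaussianPi i).const_mul _)
  have h2 := integral_mono hY.integrable_sq (hIX.add hI2) hpt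
  simp only [Pi.add_apply] at h2
  rw [integral_add hIX hI2, integral_sub ((integrable_sq_eval_stdGaussianPi i₀).const_mul _)
      ((integrable_sq_eval_stdGaussianPi i).const_mul _), integral_const_mul, integral_const_mul,
    integral_sq_eval_stdGaussianPi, integral_sq_eval_stdGaussianPi] at h2
  have h3 : ∫ x, (colErr r θ x i - 1 / 2 * x i) ∂(stdGaussianPi p) =
      ∫ x, colErr r θ x i ∂(stdGaussianPi p) := by
    rw [integral_sub (hX.integrable (by norm_num)) ((hξ.const_mul _).integrable (by norm_num)),
      integral_const_mul, integral_eval_stdGaussianPi]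
    ring
  rw [variance_eq_sub hY, h3] at h1
  rw [variance_eq_sub hX]
  simp only [Pi.pow_apply] at h1 ⊢
  linarith

/-- The matrix whose columns in `S` equal `θ`, the others being zero. -/
def constCols {p n : ℕ} (S : Finset (Fin n)) (θ : Fin p → ℝ) : Fin n → Fin p → ℝ :=
  fun j => if j ∈ S then θ else 0

lemma smul_constCols_mem_ColSparse {p n s : ℕ} {S : Finset (Fin n)} (hS : S.card ≤ s) (a : ℝ)
    (θ : Fin p → ℝ) : a • constCols S θ ∈ ColSparse p n s :=
  ⟨S, hS, fun j hj => by simp [constCols, hj]⟩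

lemma card_mul_le_ghtRisk {p n : ℕ} {r : ℝ} (hr : 0 < r) {θ : Fin p → ℝ} {i₀ : Fin p}
    (hθ : θ i₀ = 3 * r) (S : Finset (Fin n)) :
    (S.card * p : ℝ) / 4 ≤ ghtRisk r (constCols S θ) := by
  have h (i : Fin p) : (S.card : ℝ) / 4 ≤
      ∑ j, Var[fun x => colErr r (constCols S θ j) x i; stdGaussianPi p] +
        (∑ j, ∫ x, colErr r (constCols S θ j) x i ∂(stdGaussianPi p)) ^ 2 := by
    have h1 : ∑ j ∈ S, (1 / 4 : ℝ) ≤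
        ∑ j ∈ S, Var[fun x => colErr r (constCols S θ j) x i; stdGaussianPi p] := by
      refine Finset.sum_le_sum fun j hj => ?_
      rw [show constCols S θ j = θ by simp [constCols, hj]]
      exact variance_colErr_ge hr hθ i
    have h2 := Finset.sum_le_sum_of_subset_of_nonneg (Finset.subset_univ S)
      (f := fun j => Var[fun x => colErr r (constCols S θ j) x i; stdGaussianPi p])
      fun j _ _ => variance_nonneg _ _
    rw [Finset.sum_const, nsmul_eq_mul] at h1
    nlinarith [sq_nonneg (∑ j, ∫ x, colErr r (constCols S θ j) x i ∂(stdGaussianPi p))]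
  calc (S.card * p : ℝ) / 4 = ∑ i : Fin p, (S.card : ℝ) / 4 := by simp; ring
    _ ≤ _ := Finset.sum_le_sum fun i _ => h i

lemma measurePreserving_neg_stdGaussianPi (p : ℕ) :
    MeasurePreserving (fun x : Fin p → ℝ => -x) (stdGaussianPi p) (stdGaussianPi p) :=
  measurePreserving_pi _ _ fun _ => ⟨measurable_neg, by
    have := gaussianReal_map_neg (μ := 0) (v := 1)
    rwa [neg_zero] at this⟩

lemma integral_colErr_zero {p : ℕ} (r : ℝ) (i : Fin p) :
    ∫ x, colErr r 0 x i ∂(stdGaussianPi p) = 0 := by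
  have h := (measurePreserving_neg_stdGaussianPi p).integral_comp
    (MeasurableEquiv.neg (Fin p → ℝ)).measurableEmbedding (fun x => colErr r 0 x i)
  have h2 (x : Fin p → ℝ) : colErr r 0 (-x) i = -colErr r 0 x i := by
    have : sqnorm (-x) = sqnorm x := by simp [sqnorm]
    simp only [colErr, zero_add, this]
    split_ifs <;> simp
  simp_rw [h2] at h
  rw [integral_neg] at h
  linarith

lemma mul_measureReal_le_ghtRisk_zero {p n : ℕ} {r D : ℝ} (hD : 0 ≤ D)
    (hrD : r ^ 2 ≤ p + D) :
    n * (p * (stdGaussianPi p).real {x | p + D ≤ sqnorm x}) ≤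
      ghtRisk r (0 : Fin n → Fin p → ℝ) := by
  have hA : MeasurableSet {x : Fin p → ℝ | p + D ≤ sqnorm x} :=
    measurableSet_le measurable_const measurable_sqnorm
  have hint (i : Fin p) := (memLp_colErr r 0 i).integrable_sq
  have h1 : ghtRisk r (0 : Fin n → Fin p → ℝ) =
      n * ∫ x, ∑ i, colErr r 0 x i ^ 2 ∂(stdGaussianPi p) := by
    rw [integral_finsetSum _ fun i _ => hint i, ghtRisk, Finset.mul_sum]
    refine Finset.sum_congr rfl fun i _ => ?_
    simp only [Pi.zero_apply, integral_colErr_zero, variance_eq_sub (memLp_colErr r 0 i)]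
    simp
  rw [h1]
  gcongr
  rw [mul_comm, ← smul_eq_mul, ← integral_indicator_const _ hA]
  refine integral_mono ((integrable_const _).indicator hA)
    (integrable_finsetSum _ fun i _ => hint i) fun x => ?_
  have hnn : 0 ≤ ∑ i, colErr r 0 x i ^ 2 := Finset.sum_nonneg fun _ _ => sq_nonneg _
  by_cases hx : x ∈ {x : Fin p → ℝ | p + D ≤ sqnorm x}
  · rw [Set.indicator_of_mem hx]
    change p + D ≤ sqnorm x at hx
    have hrx : r ≤ √(sqnorm x) := le_sqrt_of_sq_le (hrD.trans hx)
    simp only [colErr, zero_add, hrx, if_true, Pi.zero_apply, sub_zero]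
    change (p : ℝ) ≤ sqnorm x
    linarith
  · rwa [Set.indicator_of_notMem hx]

lemma sqnorm_single_add {p : ℕ} (i₀ : Fin p) (τ : ℝ) (x : Fin p → ℝ) :
    sqnorm (Pi.single i₀ τ + x) =
      sqnorm x + 2 * τ * x i₀ + τ ^ 2 := by
  have h (i : Fin p) : ((Pi.single i₀ τ + x : Fin p → ℝ) i) ^ 2 =
      x i ^ 2 + if i = i₀ then 2 * τ * x i₀ + τ ^ 2 else 0 := by
    by_cases hi : i = i₀
    · subst hi; simp; ring
    · simp [hi]
  simp only [sqnorm, h, Finset.sum_add_distrib, Finset.sum_ite_eq', Finset.mem_univ, if_true]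
  ring

lemma integral_colErr_single_le {p : ℕ} {r τ : ℝ} (i₀ : Fin p) (hp : 16 ≤ p) (hr : 0 < r)
    (hτ : 0 < τ) (hτp : 5 * √p ≤ τ ^ 2) (hτr : p + 4 * τ ^ 2 ≤ r ^ 2) :
    ∫ x, colErr r (Pi.single i₀ τ) x i₀ ∂(stdGaussianPi p) ≤ -(τ / 2) := by
  have hp' : (16 : ℝ) ≤ p := by exact_mod_cast hp
  have hs4 : 4 ≤ √(p : ℝ) := le_sqrt_of_sq_le (by linarith)
  have hs0 : 0 < √(p : ℝ) := by linarith
  have hsq : √(p : ℝ) ^ 2 = p := sq_sqrt (by linarith)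
  set t : ℝ := 1 / √p with ht
  have ht0 : 0 < t := by positivity
  have ht4 : t ≤ 1 / 4 := by
    rw [ht]; exact one_div_le_one_div_of_le (by norm_num) hs4
  have hpt : p * t ^ 2 = 1 := by rw [ht, div_pow, hsq]; field_simp
  have hpt5 : 5 ≤ t * τ ^ 2 := by
    rw [ht, one_div, ← div_eq_inv_mul, le_div_iff₀ hs0]; exact hτp
  have hW0 : Integrable (fun x : Fin p → ℝ => exp (t * (sqnorm x - p))) (stdGaussianPi p) :=
    integrable_exp_mul_sqnorm_sub (by linarith)
  have hW := integral_exp_mul_sqnorm_sub_le (p := p) ht0.le ht4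
  rw [show (p : ℝ) * (2 * t ^ 2) = 2 by linarith] at hW
  have hpt (x : Fin p → ℝ) : colErr r (Pi.single i₀ τ) x i₀ ≤
      1 / (8 * τ) * (τ ^ 2 + 2 * τ * x i₀ + x i₀ ^ 2) +
        2 * τ * (exp (-5) * exp (t * (sqnorm x - p)) + 1 / τ ^ 2 * x i₀ ^ 2) - τ := by
    unfold colErr
    simp only [sqnorm_single_add, Pi.add_apply, Pi.single_eq_same]
    have e1 : 1 / (8 * τ) * (τ ^ 2 + 2 * τ * x i₀ + x i₀ ^ 2) = (τ + x i₀) ^ 2 / (8 * τ) := by ring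
    rw [e1]
    have hexp : 0 ≤ exp (-5) * exp (t * (sqnorm x - p)) := by positivity
    have hq : 0 ≤ 1 / τ ^ 2 * x i₀ ^ 2 := by positivity
    split_ifs with h
    · rw [le_sqrt' hr] at h
      have hge : 1 ≤ exp (-5) * exp (t * (sqnorm x - p)) + 1 / τ ^ 2 * x i₀ ^ 2 := by
        rcases le_or_gt (p + τ ^ 2) (sqnorm x) with h2 | h2
        · have h3 : t * τ ^ 2 ≤ t * (sqnorm x - p) := by gcongr; linarith
          have : 1 ≤ exp (-5) * exp (t * (sqnorm x - p)) := by
            rw [← exp_add]; exact one_le_exp (by linarith)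
          linarith
        · have h3 : 2 * τ * τ ≤ 2 * τ * x i₀ := by nlinarith
          have h4 : τ ≤ x i₀ := le_of_mul_le_mul_left h3 (by linarith)
          have h5 : 1 ≤ 1 / τ ^ 2 * x i₀ ^ 2 := by
            rw [one_div, ← div_eq_inv_mul, le_div_iff₀ (by positivity), one_mul]
            gcongr
          linarith
      have h6 : τ + x i₀ ≤ (τ + x i₀) ^ 2 / (8 * τ) + 2 * τ := by
        have : (τ + x i₀) ^ 2 / (8 * τ) + 2 * τ - (τ + x i₀) = (τ + x i₀ - 4 * τ) ^ 2 / (8 * τ) := by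
          field_simp; ring
        have h7 : 0 ≤ (τ + x i₀ - 4 * τ) ^ 2 / (8 * τ) := by positivity
        linarith
      nlinarith
    · have h6 : 0 ≤ (τ + x i₀) ^ 2 / (8 * τ) := by positivity
      nlinarith
  have hξ := (memLp_eval_stdGaussianPi i₀).integrable (by norm_num : (1 : ENNReal) ≤ 2)
  have hξ2 := integrable_sq_eval_stdGaussianPi i₀
  have hi0 : Integrable (fun x : Fin p → ℝ => τ ^ 2 + 2 * τ * x i₀) (stdGaussianPi p) :=
    (integrable_const _).add (hξ.const_mul _)
  have hi1 : Integrable (fun x : Fin p → ℝ => 1 / (8 * τ) * (τ ^ 2 + 2 * τ * x i₀ + x i₀ ^ 2))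
      (stdGaussianPi p) := (hi0.add hξ2).const_mul _
  have hi2 : Integrable (fun x : Fin p → ℝ => 2 * τ * (exp (-5) * exp (t * (sqnorm x - p)) +
      1 / τ ^ 2 * x i₀ ^ 2)) (stdGaussianPi p) :=
    ((hW0.const_mul _).add (hξ2.const_mul _)).const_mul _
  have hi3 : Integrable (fun x : Fin p → ℝ =>
      1 / (8 * τ) * (τ ^ 2 + 2 * τ * x i₀ + x i₀ ^ 2) +
        2 * τ * (exp (-5) * exp (t * (sqnorm x - p)) + 1 / τ ^ 2 * x i₀ ^ 2))
      (stdGaussianPi p) := hi1.add hi2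
  have h := integral_mono ((memLp_colErr r (Pi.single i₀ τ) i₀).integrable (by norm_num))
    (hi3.sub (integrable_const τ)) hpt
  simp only [Pi.sub_apply] at h
  rw [integral_sub hi3 (integrable_const τ), integral_add hi1 hi2,
    integral_const_mul, integral_const_mul, integral_add (hW0.const_mul _) (hξ2.const_mul _),
    integral_add hi0 hξ2, integral_add (integrable_const _) (hξ.const_mul _),
    integral_const_mul, integral_const_mul, integral_const_mul, integral_eval_stdGaussianPi,
    integral_sq_eval_stdGaussianPi] at h
  simp only [integral_const, probReal_univ, smul_eq_mul, one_mul] at h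
  have hE : exp (-5) * ∫ x, exp (t * (sqnorm x - p)) ∂(stdGaussianPi p) ≤ 1 / 16 := by
    calc _ ≤ exp (-5) * exp 2 := by gcongr
      _ = exp (-3) := by rw [← exp_add]; norm_num
      _ ≤ 1 / 16 := by
        rw [exp_neg, one_div]
        apply inv_anti₀ (by norm_num)
        have h3 : exp 3 = exp 1 ^ 3 := by rw [← exp_nat_mul]; norm_num
        rw [h3]
        calc (16 : ℝ) ≤ 2.7 ^ 3 := by norm_num
          _ ≤ exp 1 ^ 3 := by gcongr; linarith [exp_one_gt_d9]
  have hτ20 : 20 ≤ τ ^ 2 := by linarith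
  have hT : 1 / τ ^ 2 * 1 ≤ 1 / 16 := by
    rw [mul_one]; exact one_div_le_one_div_of_le (by norm_num) (by linarith)
  have h8 : 1 / (8 * τ) * (τ ^ 2 + 2 * τ * 0 + 1) ≤ τ / 4 := by
    rw [one_div, ← div_eq_inv_mul, div_le_iff₀ (by positivity)]; nlinarith
  nlinarith

lemma mul_sq_le_ghtRisk {p n : ℕ} {r τ : ℝ} (i₀ : Fin p) (hp : 16 ≤ p) (hr : 0 < r)
    (hτ : 0 < τ) (hτp : 5 * √p ≤ τ ^ 2) (hτr : p + 4 * τ ^ 2 ≤ r ^ 2) (S : Finset (Fin n)) :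
    (S.card : ℝ) ^ 2 * (τ ^ 2 / 4) ≤ ghtRisk r (constCols S (Pi.single i₀ τ)) := by
  have hm := integral_colErr_single_le i₀ hp hr hτ hτp hτr
  set m := ∫ x, colErr r (Pi.single i₀ τ) x i₀ ∂(stdGaussianPi p)
  have h1 : ∑ j, ∫ x, colErr r (constCols S (Pi.single i₀ τ) j) x i₀ ∂(stdGaussianPi p) =
      S.card * m := by
    have h2 (j : Fin n) : ∫ x, colErr r (constCols S (Pi.single i₀ τ) j) x i₀ ∂(stdGaussianPi p) =
        if j ∈ S then m else 0 := by
      by_cases hj : j ∈ S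
      · simp [constCols, hj, m]
      · simp [constCols, hj, integral_colErr_zero]
    simp [h2]
  have h3 : (S.card : ℝ) ^ 2 * (τ ^ 2 / 4) ≤ (S.card * m) ^ 2 := by
    rw [mul_pow]
    gcongr
    nlinarith
  refine h3.trans ?_
  rw [← h1]
  refine le_trans ?_ (Finset.single_le_sum (fun i _ => add_nonneg
    (Finset.sum_nonneg fun j _ => variance_nonneg _ _) (sq_nonneg _)) (Finset.mem_univ i₀))
  exact le_add_of_nonneg_left (Finset.sum_nonneg fun j _ => variance_nonneg _ _)

lemma exists_le_ghtRisk_of_le_add {p n s : ℕ} {r R X Y K₁ K₂ c : ℝ} (hc : 0 < c)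
    (hK₁ : 0 ≤ K₁) (hK₂ : 0 ≤ K₂) (hcK : c * (K₁ + K₂) ≤ 1) (hY0 : 0 ≤ Y)
    (hX : ∃ Θ : Fin n → Fin p → ℝ, (∀ σ : ℝ, σ • Θ ∈ ColSparse p n s) ∧ X ≤ ghtRisk r Θ)
    (hY : ∃ Θ : Fin n → Fin p → ℝ, (∀ σ : ℝ, σ • Θ ∈ ColSparse p n s) ∧ Y ≤ ghtRisk r Θ)
    (hR : R ≤ K₁ * X + K₂ * Y) :
    ∃ Θ : Fin n → Fin p → ℝ, (∀ σ : ℝ, σ • Θ ∈ ColSparse p n s) ∧ c * R ≤ ghtRisk r Θ := by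
  have key (Z : ℝ) (hZ0 : 0 ≤ Z) (hXZ : X ≤ Z) (hYZ : Y ≤ Z) : c * R ≤ Z := by
    have h1 : R ≤ (K₁ + K₂) * Z := by nlinarith
    calc c * R ≤ c * ((K₁ + K₂) * Z) := by gcongr
      _ = c * (K₁ + K₂) * Z := by ring
      _ ≤ 1 * Z := by gcongr
      _ = Z := one_mul Z
  rcases le_total X Y with h | h
  · obtain ⟨Θ, h1, h2⟩ := hY
    exact ⟨Θ, h1, (key Y hY0 h le_rfl).trans h2⟩
  · obtain ⟨Θ, h1, h2⟩ := hX
    exact ⟨Θ, h1, (key X (hY0.trans h) le_rfl h).trans h2⟩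

lemma exists_le_ghtRisk {p n s : ℕ} {r : ℝ} (hp : 102400 ≤ p) (hs : 1 ≤ s) (hsn : s ≤ n)
    (hr : 0 < r) :
    ∃ Θ : Fin n → Fin p → ℝ, (∀ σ : ℝ, σ • Θ ∈ ColSparse p n s) ∧
      exp (-9600) / 80000 * (min ((s : ℝ) ^ 2 * √p) ((n : ℝ) * p) +
        (s : ℝ) ^ 2 * log (1 + (n : ℝ) / (s : ℝ) ^ 2) + s * p) ≤ ghtRisk r Θ := by
  have hp' : (102400 : ℝ) ≤ p := by exact_mod_cast hp
  have hs' : (1 : ℝ) ≤ s := by exact_mod_cast hs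
  have hsn' : (s : ℝ) ≤ n := by exact_mod_cast hsn
  have hp0 : (0 : ℝ) < p := by linarith
  have hs2 : (0 : ℝ) < (s : ℝ) ^ 2 := by positivity
  have hsq : √(p : ℝ) ^ 2 = p := sq_sqrt hp0.le
  have hq : 320 ≤ √(p : ℝ) := le_sqrt_of_sq_le (by linarith)
  have hq0 : 0 < √(p : ℝ) := by linarith
  have hc : 0 < exp (-9600) / 80000 := by positivity
  have hexp1 : exp (-9600) ≤ 1 := exp_le_one_iff.2 (by norm_num)
  set L : ℝ := log (1 + (n : ℝ) / (s : ℝ) ^ 2) with hL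
  have hexpL : exp L = 1 + (n : ℝ) / (s : ℝ) ^ 2 := exp_log (by positivity)
  have hnL : (n : ℝ) = (s : ℝ) ^ 2 * (exp L - 1) := by rw [hexpL]; field_simp; ring
  have hLn : (s : ℝ) ^ 2 * L ≤ n := by
    rw [hnL]
    exact mul_le_mul_of_nonneg_left (by linarith [add_one_le_exp L]) hs2.le
  have hL0 : 0 ≤ L := log_nonneg (by linarith [show 0 ≤ (n : ℝ) / (s : ℝ) ^ 2 by positivity])
  obtain ⟨S, -, hS⟩ := Finset.exists_subset_card_eq
    (s := (Finset.univ : Finset (Fin n))) (n := s) (by simpa using hsn)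
  have hnull (X : ℝ) (h : X ≤ ghtRisk r (0 : Fin n → Fin p → ℝ)) :
      ∃ Θ : Fin n → Fin p → ℝ, (∀ σ : ℝ, σ • Θ ∈ ColSparse p n s) ∧ X ≤ ghtRisk r Θ :=
    ⟨0, fun σ => ⟨∅, by simp, by simp⟩, h⟩
  have hvar : ∃ Θ : Fin n → Fin p → ℝ, (∀ σ : ℝ, σ • Θ ∈ ColSparse p n s) ∧
      (s * p : ℝ) / 4 ≤ ghtRisk r Θ := by
    refine ⟨constCols S fun _ => 3 * r, fun σ => smul_constCols_mem_ColSparse hS.le σ _, ?_⟩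
    rw [← hS]
    exact card_mul_le_ghtRisk hr (i₀ := ⟨0, by omega⟩) rfl S
  have hmin1 := min_le_left ((s : ℝ) ^ 2 * √p) ((n : ℝ) * p)
  have hmin2 := min_le_right ((s : ℝ) ^ 2 * √p) ((n : ℝ) * p)
  have hsp : 0 ≤ (s * p : ℝ) / 4 := by positivity
  rcases le_or_gt (r ^ 2) (p + 20 * √p) with hr1 | hr1
  · apply hnull
    have h1 := mul_measureReal_le_ghtRisk_zero (n := n) (by positivity : 0 ≤ 20 * √(p : ℝ)) hr1
    have ht0 : 0 < 40 / √(p : ℝ) := by positivity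
    have hpt : p * (40 / √(p : ℝ)) ^ 2 = 1600 := by rw [div_pow, hsq]; field_simp; norm_num
    have hpt' : p * (40 / √(p : ℝ)) / 2 = 20 * √(p : ℝ) := by
      have : (p : ℝ) * (40 / √p) = 40 * (p / √p) := by ring
      rw [this, div_sqrt]; ring
    have h2 := exp_le_measureReal_sqnorm_ge (p := p) ht0
      (by rw [div_le_iff₀ hq0]; linarith) (by rw [hpt]; norm_num)
    rw [hpt, hpt'] at h2
    norm_num at h2
    refine le_trans ?_ h1
    have hR : min ((s : ℝ) ^ 2 * √p) ((n : ℝ) * p) + (s : ℝ) ^ 2 * L + s * p ≤ 3 * (n * p) := by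
      have : (n : ℝ) ≤ n * p := le_mul_of_one_le_right (by positivity) (by linarith)
      have : (s : ℝ) * p ≤ n * p := by gcongr
      linarith
    calc _ ≤ exp (-9600) / 80000 * (3 * (n * p)) := by gcongr
      _ ≤ n * (p * (exp (-9600) / 4)) := by
        have : 0 ≤ exp (-9600) * (n * p) := by positivity
        linarith
      _ ≤ _ := by gcongr
  have hbias : ∃ Θ : Fin n → Fin p → ℝ, (∀ σ : ℝ, σ • Θ ∈ ColSparse p n s) ∧
      (s : ℝ) ^ 2 * ((r ^ 2 - p) / 16) ≤ ghtRisk r Θ := by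
    have hτ2 : √((r ^ 2 - p) / 4) ^ 2 = (r ^ 2 - p) / 4 := sq_sqrt (by linarith)
    refine ⟨constCols S (Pi.single ⟨0, by omega⟩ √((r ^ 2 - p) / 4)),
      fun σ => smul_constCols_mem_ColSparse hS.le σ _, ?_⟩
    have := mul_sq_le_ghtRisk (r := r) (τ := √((r ^ 2 - p) / 4)) (⟨0, by omega⟩ : Fin p)
      (by omega) hr (sqrt_pos.2 (by linarith)) (by rw [hτ2]; linarith) (by rw [hτ2]; linarith) S
    rwa [hτ2, hS, div_div, show (4 : ℝ) * 4 = 16 by norm_num] at this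
  rcases le_or_gt L (500 * √p) with h500 | h500
  · refine exists_le_ghtRisk_of_le_add (K₁ := 501) (K₂ := 4) hc (by norm_num) (by norm_num)
      (by linarith) hsp hbias hvar ?_
    have h1 : (s : ℝ) ^ 2 * √p ≤ (s : ℝ) ^ 2 * ((r ^ 2 - p) / 16) := by gcongr; linarith
    have h2 : (s : ℝ) ^ 2 * L ≤ (s : ℝ) ^ 2 * (500 * √p) := by gcongr
    linarith
  have hqL : (s : ℝ) ^ 2 * √p ≤ (s : ℝ) ^ 2 * L := by gcongr; linarith
  rcases le_or_gt (L / 600) (r ^ 2 - p) with hD | hD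
  · refine exists_le_ghtRisk_of_le_add (K₁ := 19200) (K₂ := 4) hc (by norm_num) (by norm_num)
      (by linarith) hsp hbias hvar ?_
    have h1 : (s : ℝ) ^ 2 * (L / 9600) ≤ (s : ℝ) ^ 2 * ((r ^ 2 - p) / 16) :=
      mul_le_mul_of_nonneg_left (by linarith) hs2.le
    linarith
  · have h1 := mul_measureReal_le_ghtRisk_zero (p := p) (n := n) (r := r)
      (by positivity : 0 ≤ L / 600) (by linarith)
    have h2 := exp_le_measureReal_sqnorm_ge_of_sqrt_le (p := p) (by omega) h500.le
    have h3 : (s : ℝ) ^ 2 * L / 16 ≤ ghtRisk r (0 : Fin n → Fin p → ℝ) := by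
      refine le_trans ?_ h1
      have hn2 : (s : ℝ) ^ 2 * (exp L / 2) ≤ n := by
        rw [hnL]
        gcongr
        linarith [add_one_le_exp L]
      calc (s : ℝ) ^ 2 * L / 16 = (s : ℝ) ^ 2 * ((L / 2) / 8) := by ring
        _ ≤ (s : ℝ) ^ 2 * (exp (L / 2) / 8) := by
          gcongr
          linarith [add_one_le_exp (L / 2)]
        _ = (s : ℝ) ^ 2 * (exp L / 2) * (1 * (exp (-(L / 2)) / 4)) := by
          have : exp (L / 2) = exp L * exp (-(L / 2)) := by rw [← exp_add]; ring_nf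
          rw [this]; ring
        _ ≤ n * (p * (stdGaussianPi p).real {x | p + L / 600 ≤ sqnorm x}) := by
          gcongr
          linarith
    refine exists_le_ghtRisk_of_le_add (K₁ := 32) (K₂ := 4) hc (by norm_num) (by norm_num)
      (by linarith) hsp (hnull _ h3) hvar ?_
    linarith

/-- Proposition 2.3 (lower bound for group hard thresholding): there are universal constants
`p₀ ∈ ℕ` and `c > 0` such that for every `p ≥ p₀` and `s ≤ n/61`, for every choice of the
threshold `λ > 0` there is `Θ ∈ M(p,n,s)` with
`E_Θ ‖L̂^GHT_λ - L(Θ)‖₂² ≥ c σ² ((s² p^{1/2}) ∧ (np) + s² log(1+n/s²) + s p)`. -/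
theorem ght_lower_bound :
    ∃ (p₀ : ℕ) (c : ℝ), 0 < c ∧
      ∀ (p n s : ℕ) (σ : ℝ), 0 < σ → p₀ ≤ p → 1 ≤ s → (s : ℝ) ≤ (n : ℝ) / 61 →
        ∀ lam : ℝ, 0 < lam →
          ∃ Θ ∈ ColSparse p n s,
            ENNReal.ofReal (c * σ ^ 2 *
                (min ((s : ℝ) ^ 2 * Real.sqrt p) ((n : ℝ) * p) +
                  (s : ℝ) ^ 2 * Real.log (1 + (n : ℝ) / (s : ℝ) ^ 2) + s * p)) ≤
              ∫⁻ ξ, ENNReal.ofReal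
                (sqnorm (ghtEst lam (fun j => Θ j + σ • ξ j) - Lfun Θ)) ∂(noiseMeasure p n) := by
  refine ⟨102400, exp (-9600) / 80000, by positivity, ?_⟩
  intro p n s σ hσ hp hs hsn lam hlam
  have hsn' : s ≤ n := by
    have : (s : ℝ) ≤ n := hsn.trans (div_le_self (by positivity) (by norm_num))
    exact_mod_cast this
  obtain ⟨Θ, hΘ, hrisk⟩ := exists_le_ghtRisk (r := lam / σ) hp hs hsn' (by positivity)
  refine ⟨σ • Θ, hΘ σ, ?_⟩
  rw [lintegral_sqnorm_ghtEst hσ, mul_comm _ (σ ^ 2), mul_assoc]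
  exact ENNReal.ofReal_le_ofReal (mul_le_mul_of_nonneg_left hrisk (sq_nonneg σ))
end
end

section
/- Let a ≥ 0 and let (ε_k)_{k≥0} be a sequence of nonnegative reals satisfying ε_{k+1} ≤ (8s/n)·(2ε_k² + (4ε_k⁴ + p·ε_k²)^{1/2})^{1/2} + a for all k ≥ 0. If ε₀² ≤ p, n ≥ 33s and a ≤ 0.5√p, then for every k ≥ 0: ε_k ≤ { p^{1/2} · (33² s²/n²)^{1 − (1/2)^k} } ∨ 2a. -/
/-- For `0 ≤ e ≤ P`, the inner map of the recursion is at most `(33 / 16) √(P e)`. -/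
theorem sqrt_two_mul_sq_add_sqrt_le {P e : ℝ} (he : 0 ≤ e) (heP : e ≤ P) :
    Real.sqrt (2 * e ^ 2 + Real.sqrt (4 * e ^ 4 + P ^ 2 * e ^ 2)) ≤
      33 / 16 * Real.sqrt (P * e) := by
  have hPe : 0 ≤ P * e := mul_nonneg (he.trans heP) he
  have hsq : e ^ 2 ≤ P * e := by nlinarith
  have hinner : Real.sqrt (4 * e ^ 4 + P ^ 2 * e ^ 2) ≤ 9 / 4 * (P * e) := by
    apply Real.sqrt_le_iff.mpr
    refine ⟨by positivity, ?_⟩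
    have h4 : (e ^ 2) ^ 2 ≤ (P * e) ^ 2 := by gcongr
    nlinarith [sq_nonneg (P * e)]
  apply Real.sqrt_le_iff.mpr
  refine ⟨by positivity, ?_⟩
  rw [mul_pow, Real.sq_sqrt hPe]
  nlinarith

/-- If `w' ^ 2 = r ^ 2 * w` and `r ^ 2 ≤ w'`, the map `e ↦ r √(P e)` sends the bound
`max (P w) b` to `max (P w') b`. -/
theorem mul_sqrt_le_max {P r e b w w' : ℝ} (hP : 0 ≤ P) (hb : 0 ≤ b)
    (hww' : w' ^ 2 = r ^ 2 * w) (hrw' : r ^ 2 ≤ w') (he : e ≤ max (P * w) b) :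
    r * Real.sqrt (P * e) ≤ max (P * w') b := by
  have hw' : 0 ≤ w' := (sq_nonneg r).trans hrw'
  have hM : 0 ≤ max (P * w') b := hb.trans (le_max_right _ _)
  rcases le_or_gt (P * e) 0 with hPe | hPe
  · rwa [Real.sqrt_eq_zero_of_nonpos hPe, mul_zero]
  apply le_of_sq_le_sq ?_ hM
  rw [mul_pow, Real.sq_sqrt hPe.le]
  rcases le_max_iff.mp he with h | h
  · calc r ^ 2 * (P * e) ≤ r ^ 2 * (P * (P * w)) := by gcongr
      _ = (P * w') ^ 2 := by rw [mul_pow, hww']; ring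
      _ ≤ max (P * w') b ^ 2 := by gcongr; exact le_max_left _ _
  · calc r ^ 2 * (P * e) ≤ w' * (P * b) := by gcongr
      _ = (P * w') * b := by ring
      _ ≤ max (P * w') b * max (P * w') b := by
        gcongr
        · exact le_max_left _ _
        · exact le_max_right _ _
      _ = max (P * w') b ^ 2 := (sq _).symm

/-- Lemma 3.5 (recursion): let `a ≥ 0` and `(ε_k)` be nonnegative reals with
`ε_{k+1} ≤ (8s/n) (2ε_k² + (4ε_k⁴ + p ε_k²)^{1/2})^{1/2} + a`. If `ε₀² ≤ p`, `n ≥ 33 s` and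
`a ≤ 0.5 √p`, then `ε_k ≤ (p^{1/2} (33² s²/n²)^{1 - (1/2)^k}) ∨ 2a` for every `k`. -/
theorem recursion_lemma (p : ℝ) (s n : ℕ) (hp : 0 < p) (hs : 0 < s) (hn : 0 < n)
    (a : ℝ) (ha : 0 ≤ a) (ε : ℕ → ℝ) (hε : ∀ k, 0 ≤ ε k)
    (hrec : ∀ k, ε (k + 1) ≤
      8 * s / n * Real.sqrt (2 * ε k ^ 2 + Real.sqrt (4 * ε k ^ 4 + p * ε k ^ 2)) + a)
    (h0 : ε 0 ^ 2 ≤ p) (hns : 33 * s ≤ n) (hap : a ≤ 0.5 * Real.sqrt p) :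
    ∀ k, ε k ≤
      max (Real.sqrt p * ((33 ^ 2 * (s : ℝ) ^ 2 / (n : ℝ) ^ 2) ^ ((1 : ℝ) - (1 / 2) ^ k)))
        (2 * a) := by
  have hs' : (0 : ℝ) < s := by exact_mod_cast hs
  have hn' : (0 : ℝ) < n := by exact_mod_cast hn
  have hns' : 33 * (s : ℝ) ≤ n := by exact_mod_cast hns
  obtain ⟨P, hP⟩ : ∃ P, P = Real.sqrt p := ⟨_, rfl⟩
  obtain ⟨r, hr⟩ : ∃ r : ℝ, r = 33 * s / n := ⟨_, rfl⟩
  have hP0 : 0 < P := hP ▸ Real.sqrt_pos.mpr hp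
  have hPp : p = P ^ 2 := by rw [hP, Real.sq_sqrt hp.le]
  have hr0 : 0 < r := by rw [hr]; positivity
  have hr1 : r ≤ 1 := by rw [hr, div_le_one hn']; exact hns'
  have hq0 : 0 < r ^ 2 := by positivity
  have hq1 : r ^ 2 ≤ 1 := pow_le_one₀ hr0.le hr1
  have hq : 33 ^ 2 * (s : ℝ) ^ 2 / (n : ℝ) ^ 2 = r ^ 2 := by rw [hr, div_pow, mul_pow]
  have hcoef : 8 * (s : ℝ) / n = 8 / 33 * r := by rw [hr]; ring
  rw [hq, ← hP]
  rw [← hP] at hap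
  rw [hPp] at h0 hrec
  rw [hcoef] at hrec
  intro k
  induction k with
  | zero =>
    refine le_max_of_le_left ?_
    simpa using (sq_le_sq₀ (hε 0) hP0.le).mp h0
  | succ k ih =>
    have hhalf : ((1 : ℝ) / 2) ^ k ≤ 1 := pow_le_one₀ (by norm_num) (by norm_num)
    have hw1 : (r ^ 2) ^ ((1 : ℝ) - (1 / 2) ^ k) ≤ 1 :=
      Real.rpow_le_one hq0.le hq1 (by linarith)
    have heP : ε k ≤ P := by
      refine ih.trans (max_le ?_ (by linarith))
      exact mul_le_of_le_one_right hP0.le hw1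
    have hww' : ((r ^ 2) ^ ((1 : ℝ) - (1 / 2) ^ (k + 1))) ^ 2 =
        r ^ 2 * (r ^ 2) ^ ((1 : ℝ) - (1 / 2) ^ k) := by
      rw [← Real.rpow_mul_natCast hq0.le, ← Real.rpow_one_add' hq0.le (by linarith)]
      congr 1
      push_cast
      ring
    have hrw' : r ^ 2 ≤ (r ^ 2) ^ ((1 : ℝ) - (1 / 2) ^ (k + 1)) := by
      apply Real.self_le_rpow_of_le_one hq0.le hq1
      have : (0 : ℝ) < (1 / 2) ^ (k + 1) := by positivity
      linarith
    have hstep := mul_sqrt_le_max hP0.le (by linarith : 0 ≤ 2 * a) hww' hrw' ih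
    have hbound := mul_le_mul_of_nonneg_left (sqrt_two_mul_sq_add_sqrt_le (hε k) heP)
      (by positivity : 0 ≤ 8 / 33 * r)
    have ha' := le_max_right (P * (r ^ 2) ^ ((1 : ℝ) - (1 / 2) ^ (k + 1))) (2 * a)
    linarith [hrec k]
end

section
/- Let Z_i = (YΠ)_i + L̃_n, let w_i = (1 − σγ/√((‖Z_i‖₂² − ((n−1)/n)σ²p)₊))₊, and define the events Ω₁ = { ‖L̃_n − L_n(Θ)‖₂ < σγ²/(4√(p+γ²)) } and Ω₂ = { max_i |‖ξ̄_i‖₂² − (1 − 1/n)p| ≤ 0.5γ² }, where ξ̄_i = ξ_i − (1/n)Σ_{j=1}^n ξ_j. Then: (i) on the event Ω₁ ∩ Ω₂, w_i = 0 for every i ∉ S; and (ii) if γ² > 4·log(4n/δ) + 4·{p·log(4n/δ)}^{1/2} then P(Ω₂) ≥ 1 − δ/2. -/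
open MeasureTheory ProbabilityTheory Real

noncomputable section

/-- The normalized linear functional `L_n(Θ) = (1/n) Θ 1_n`, the average of the columns. -/
def LnFun {p n : ℕ} (Θ : Fin n → Fin p → ℝ) : Fin p → ℝ := (n : ℝ)⁻¹ • ∑ j, Θ j

/-- The data matrix `Y = μ 1_nᵀ + Θ + σ Ξ` of the contaminated mean model, as a function of
the noise (all matrices are given by their columns). -/
def Ymat {p n : ℕ} (μ : Fin p → ℝ) (Θ : Fin n → Fin p → ℝ) (σ : ℝ)
    (ξ : Fin n → Fin p → ℝ) : Fin n → Fin p → ℝ :=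
  fun j => μ + Θ j + σ • ξ j

/-- The `i`-th column of `M Π`, where `Π = I_n - (1/n) J_n`: `(MΠ)_i = M_i - (1/n) ∑_j M_j`. -/
def colPi {p n : ℕ} (M : Fin n → Fin p → ℝ) : Fin n → Fin p → ℝ :=
  fun j => M j - (n : ℝ)⁻¹ • ∑ k, M k

/-- The soft-thresholding weight `w = (1 - σγ/(‖z‖₂² - ((n-1)/n)σ²p)₊^{1/2})₊` (equal to `0`
when `‖z‖₂² ≤ ((n-1)/n)σ²p`). -/
def istWeight (p n : ℕ) (σ γ : ℝ) (z : Fin p → ℝ) : ℝ :=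
  if ((n : ℝ) - 1) / n * σ ^ 2 * p < sqnorm z then
    max (1 - σ * γ / Real.sqrt (sqnorm z - ((n : ℝ) - 1) / n * σ ^ 2 * p)) 0
  else 0

/-- Swapping the two indices preserves an iterated product of a single probability measure. -/
lemma map_swap_pi_pi {ι κ X : Type*} [Fintype ι] [Fintype κ] [MeasurableSpace X] (ν : Measure X)
    [IsProbabilityMeasure ν] :
    (Measure.pi fun _ : ι => Measure.pi fun _ : κ => ν).map (fun ξ k j => ξ j k) =
      Measure.pi fun _ : κ => Measure.pi fun _ : ι => ν := by
  have key := Measure.infinitePi_map_curry (fun (_ : ι) (_ : κ) => ν)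
  have key' := Measure.infinitePi_map_curry (fun (_ : κ) (_ : ι) => ν)
  have hcongr := Measure.infinitePi_map_piCongrLeft (fun _ : κ × ι => ν) (Equiv.prodComm ι κ)
  simp only [Measure.infinitePi_eq_pi] at key key' hcongr
  rw [← key, ← key', ← hcongr, Measure.map_map (by fun_prop) (by fun_prop),
    Measure.map_map (by fun_prop) (by fun_prop)]
  rfl

/-- A linear combination of i.i.d. standard Gaussian variables is Gaussian. -/
lemma map_sum_mul_pi_gaussianReal {ι : Type*} [Fintype ι] (c : ι → ℝ) :
    (Measure.pi fun _ : ι => gaussianReal 0 1).map (fun r => ∑ j, c j * r j) =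
      gaussianReal 0 (∑ j, c j ^ 2).toNNReal := by
  have hind : iIndepFun (fun (j : ι) (r : ι → ℝ) => c j * r j)
      (Measure.pi fun _ : ι => gaussianReal 0 1) :=
    iIndepFun_pi (X := fun j (x : ℝ) => c j * x) (fun j => by fun_prop)
  have hlaw (j : ι) : (Measure.pi fun _ : ι => gaussianReal 0 1).map (fun r => c j * r j) =
      (gaussianReal 0 1).map (fun x => c j * x) := by
    conv_rhs => rw [← (measurePreserving_eval (fun _ : ι => gaussianReal 0 1) j).map_eq]
    rw [Measure.map_map (by fun_prop) (by fun_prop)]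
    rfl
  refine Measure.ext_of_charFun ?_
  rw [hind.charFun_map_fun_sum_eq_prod (fun j => Measurable.aemeasurable (by fun_prop))]
  ext t
  simp only [Finset.prod_apply, hlaw, gaussianReal_map_const_mul, charFun_gaussianReal,
    ← Complex.exp_sum]
  congr 1
  have h : (((∑ j, c j ^ 2).toNNReal : ℝ) : ℂ) = ∑ j, (c j : ℂ) ^ 2 := by
    rw [Real.coe_toNNReal _ (Finset.sum_nonneg fun j _ => sq_nonneg _)]
    push_cast
    rfl
  rw [h]
  simp [Finset.sum_mul, Finset.sum_div]

/-- The moment generating function of the square of a centred Gaussian variable. -/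
lemma mgf_sq_gaussianReal {v : NNReal} {t : ℝ} (ht : 2 * (v * t) < 1) :
    mgf (fun x => x ^ 2) (gaussianReal 0 v) t = (√(1 - 2 * (v * t)))⁻¹ := by
  have hmap : gaussianReal 0 v = (gaussianReal 0 1).map (fun x => √(v : ℝ) * x) := by
    rw [gaussianReal_map_const_mul]
    congr 1
    · simp
    · ext
      simp
  rw [hmap, mgf_map (by fun_prop) (by fun_prop), mgf,
    integral_gaussianReal_eq_integral_smul one_ne_zero]
  have h (x : ℝ) : gaussianPDFReal 0 1 x •
      rexp (t * ((fun x => x ^ 2) ∘ fun x => √(v : ℝ) * x) x) =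
      (√(2 * π))⁻¹ * rexp (-(1 / 2 - v * t) * x ^ 2) := by
    simp only [gaussianPDFReal, Function.comp_apply, smul_eq_mul, mul_pow,
      Real.sq_sqrt v.coe_nonneg, NNReal.coe_one, mul_one, sub_zero]
    rw [mul_assoc, ← Real.exp_add]
    congr 2
    ring
  simp_rw [h]
  rw [integral_const_mul, integral_gaussian, ← Real.sqrt_inv, ← Real.sqrt_inv,
    ← Real.sqrt_mul (by positivity)]
  congr 1
  have : 1 / 2 - v * t ≠ 0 := by linarith
  have : 1 - 2 * (v * t) ≠ 0 := by linarith
  field_simp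

/-- The moment generating function of the squared norm of a centred noise column. -/
lemma mgf_sqnorm_colPi {p n : ℕ} (i : Fin n) {t : ℝ} (ht : 2 * ((1 - 1 / (n : ℝ)) * t) < 1) :
    mgf (fun ξ => sqnorm (colPi ξ i)) (noiseMeasure p n) t =
      (√(1 - 2 * ((1 - 1 / (n : ℝ)) * t)))⁻¹ ^ p := by
  have hn : (1 : ℝ) ≤ n := by exact_mod_cast Fin.pos i
  let c : Fin n → ℝ := fun j => (if j = i then 1 else 0) - (n : ℝ)⁻¹
  have hc : ∑ j, c j ^ 2 = 1 - 1 / (n : ℝ) := by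
    have (j : Fin n) : c j ^ 2 = (if j = i then 1 - 2 * (n : ℝ)⁻¹ else 0) + (n : ℝ)⁻¹ ^ 2 := by
      simp only [c]
      split_ifs <;> ring
    simp only [this, Finset.sum_add_distrib, Finset.sum_ite_eq', Finset.mem_univ, if_true,
      Finset.sum_const, Finset.card_univ, Fintype.card_fin, nsmul_eq_mul]
    field_simp
    ring
  have hv : 0 ≤ 1 - 1 / (n : ℝ) := by
    rw [← hc]
    positivity
  let ρ : Measure (Fin n → ℝ) := Measure.pi fun _ => gaussianReal 0 1
  let f : (Fin n → ℝ) → ℝ := fun r => (∑ j, c j * r j) ^ 2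
  have hf : Measurable f := by fun_prop
  have hcol : (fun ξ : Fin n → Fin p → ℝ => sqnorm (colPi ξ i)) =
      (∑ k, fun η : Fin p → Fin n → ℝ => f (η k)) ∘ (fun ξ k j => ξ j k) := by
    ext ξ
    simp only [sqnorm, colPi, Function.comp_apply, Finset.sum_apply, f, c, sub_mul,
      Finset.sum_sub_distrib, ite_mul, one_mul, zero_mul, Finset.sum_ite_eq', Finset.mem_univ,
      if_true, Pi.sub_apply, Pi.smul_apply, smul_eq_mul, Finset.mul_sum]
  have hind : iIndepFun (fun (k : Fin p) (η : Fin p → Fin n → ℝ) => f (η k))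
      (Measure.pi fun _ : Fin p => ρ) := iIndepFun_pi fun _ => hf.aemeasurable
  have hone (k : Fin p) : mgf (fun η : Fin p → Fin n → ℝ => f (η k))
      (Measure.pi fun _ : Fin p => ρ) t = (√(1 - 2 * ((1 - 1 / (n : ℝ)) * t)))⁻¹ := by
    have hρ : mgf (fun η : Fin p → Fin n → ℝ => f (η k)) (Measure.pi fun _ : Fin p => ρ) t =
        mgf f ρ t := by
      conv_rhs => rw [← (measurePreserving_eval (fun _ : Fin p => ρ) k).map_eq]
      have hk : Measurable fun η : Fin p → Fin n → ℝ => η k := measurable_pi_apply k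
      rw [mgf_map (Y := Function.eval k) hk.aemeasurable (by fun_prop)]
      rfl
    have hgauss : mgf f ρ t =
        mgf (fun x => x ^ 2) (gaussianReal 0 (∑ j, c j ^ 2).toNNReal) t := by
      rw [← map_sum_mul_pi_gaussianReal,
        mgf_map (Measurable.aemeasurable (by fun_prop)) (by fun_prop)]
      rfl
    rw [hρ, hgauss, hc, mgf_sq_gaussianReal] <;> rw [Real.coe_toNNReal _ hv]
    exact ht
  rw [hcol, ← mgf_map (Measurable.aemeasurable (by fun_prop)) (by fun_prop), noiseMeasure, map_swap_pi_pi,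
    hind.mgf_sum (fun k => by fun_prop)]
  simp [hone]

lemma inv_sqrt_le_exp {u b : ℝ} (hu : u < 1) (h : -Real.log (1 - u) ≤ 2 * b) :
    (√(1 - u))⁻¹ ≤ rexp b := by
  have hpos : 0 < √(1 - u) := Real.sqrt_pos.2 (by linarith)
  rw [← Real.exp_log (inv_pos.2 hpos), Real.exp_le_exp, Real.log_inv,
    Real.log_sqrt (by linarith)]
  linarith

lemma neg_log_one_sub_le {u : ℝ} (hu0 : 0 ≤ u) (hu1 : u < 1) :
    -Real.log (1 - u) ≤ u + u ^ 2 / (2 * (1 - u)) := by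
  have h1 : 0 < 1 - u := by linarith
  have hlog : 0 ≤ Real.log (1 - u)⁻¹ := Real.log_nonneg (one_le_inv₀ h1 |>.2 (by linarith))
  have h := Real.self_le_sinh_iff.2 hlog
  rw [Real.sinh_log (by positivity), Real.log_inv, inv_inv] at h
  refine h.trans_eq ?_
  field_simp
  ring

lemma neg_log_one_add_le {u : ℝ} (hu0 : 0 ≤ u) : -Real.log (1 + u) ≤ -u + u ^ 2 / 2 := by
  have h := Real.le_log_one_add_of_nonneg hu0
  have : u - u ^ 2 / 2 ≤ 2 * u / (u + 2) := by
    rw [le_div_iff₀ (by linarith)]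
    nlinarith [pow_nonneg hu0 3]
  linarith

/-- The exponent of the Chernoff bound for a chi-square deviation, at its optimal parameter. -/
lemma exists_chernoff_parameter {q x a : ℝ} (hq : 0 < q) (hx : 0 < x)
    (ha : 2 * x + 2 * √(q * x) ≤ a) :
    ∃ t, 0 ≤ t ∧ 2 * t < 1 ∧ -t * a + q * (t ^ 2 / (1 - 2 * t)) ≤ -x := by
  obtain ⟨r, hr, rfl⟩ : ∃ r, 0 < r ∧ r ^ 2 = q := ⟨√q, Real.sqrt_pos.2 hq, Real.sq_sqrt hq.le⟩
  obtain ⟨y, hy, rfl⟩ : ∃ y, 0 < y ∧ y ^ 2 = x := ⟨√x, Real.sqrt_pos.2 hx, Real.sq_sqrt hx.le⟩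
  rw [← mul_pow, Real.sqrt_sq (by positivity)] at ha
  have hd : 0 < r + 2 * y := by positivity
  have ht0 : 0 ≤ y / (r + 2 * y) := by positivity
  have h1 : 1 - 2 * (y / (r + 2 * y)) = r / (r + 2 * y) := by
    field_simp
    ring
  refine ⟨y / (r + 2 * y), ht0, ?_, ?_⟩
  · have : 0 < r / (r + 2 * y) := by positivity
    linarith
  · have h2 := mul_le_mul_of_nonneg_left ha ht0
    have h3 : y / (r + 2 * y) * (2 * y ^ 2 + 2 * (r * y)) -
        r ^ 2 * ((y / (r + 2 * y)) ^ 2 / (r / (r + 2 * y))) = y ^ 2 := by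
      field_simp
      ring
    rw [h1]
    linarith

instance {p n : ℕ} : IsProbabilityMeasure (noiseMeasure p n) := by
  unfold noiseMeasure
  infer_instance

lemma measurable_sqnorm_colPi {p n : ℕ} (i : Fin n) :
    Measurable fun ξ : Fin n → Fin p → ℝ => sqnorm (colPi ξ i) := by
  unfold sqnorm colPi
  fun_prop

lemma integrable_exp_mul_sqnorm_colPi {p n : ℕ} (i : Fin n) {t : ℝ}
    (ht : 2 * ((1 - 1 / (n : ℝ)) * t) < 1) :
    Integrable (fun ξ => rexp (t * sqnorm (colPi ξ i))) (noiseMeasure p n) := by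
  refine Integrable.of_integral_ne_zero ?_
  have h := mgf_sqnorm_colPi (p := p) i ht
  rw [mgf] at h
  rw [h]
  have : 0 < √(1 - 2 * ((1 - 1 / (n : ℝ)) * t)) := Real.sqrt_pos.2 (by linarith)
  positivity

/-- Two-sided chi-square tail bound for the squared norm of a centred noise column. -/
lemma noiseMeasure_real_deviation_le {p n : ℕ} (i : Fin n) {x a : ℝ} (hx : 0 < x)
    (ha : 2 * x + 2 * √(p * x) < a) :
    (noiseMeasure p n).real {ξ | a < |sqnorm (colPi ξ i) - (1 - 1 / (n : ℝ)) * p|} ≤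
      2 * rexp (-x) := by
  rcases Nat.eq_zero_or_pos p with rfl | hp
  · have hempty : {ξ : Fin n → Fin 0 → ℝ |
        a < |sqnorm (colPi ξ i) - (1 - 1 / (n : ℝ)) * (0 : ℕ)|} = ∅ := by
      ext ξ
      have : 0 ≤ a := by
        have := Real.sqrt_nonneg ((0 : ℕ) * x)
        linarith
      simpa [sqnorm] using this
    rw [hempty, measureReal_empty]
    positivity
  have hn : (1 : ℝ) ≤ n := by exact_mod_cast Fin.pos i
  obtain ⟨v, hv⟩ : ∃ v : ℝ, v = 1 - 1 / (n : ℝ) := ⟨_, rfl⟩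
  have hv0 : 0 ≤ v := by
    rw [hv, sub_nonneg, div_le_one (by linarith)]
    exact hn
  have hv1 : v ≤ 1 := by
    have : 0 ≤ 1 / (n : ℝ) := by positivity
    linarith
  obtain ⟨t, ht0, ht1, ht⟩ := exists_chernoff_parameter (Nat.cast_pos.2 hp) hx ha.le
  have hvt0 : 0 ≤ v * t := mul_nonneg hv0 ht0
  have hvt : v * t ≤ t := mul_le_of_le_one_left ht0 hv1
  have hdiv : (v * t) ^ 2 / (1 - 2 * (v * t)) ≤ t ^ 2 / (1 - 2 * t) := by
    gcongr
  have hsq : (v * t) ^ 2 ≤ t ^ 2 / (1 - 2 * t) := by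
    rw [le_div_iff₀ (by linarith)]
    nlinarith [pow_le_pow_left₀ hvt0 hvt 2, sq_nonneg (v * t)]
  have hup : (noiseMeasure p n).real {ξ | v * p + a ≤ sqnorm (colPi ξ i)} ≤ rexp (-x) := by
    have hlt : 2 * ((1 - 1 / (n : ℝ)) * t) < 1 := by
      rw [← hv]
      linarith
    refine (measure_ge_le_exp_mul_mgf _ ht0 (integrable_exp_mul_sqnorm_colPi i hlt)).trans ?_
    rw [mgf_sqnorm_colPi i hlt, ← hv]
    have hb : (√(1 - 2 * (v * t)))⁻¹ ≤ rexp (v * t + t ^ 2 / (1 - 2 * t)) := by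
      refine inv_sqrt_le_exp (by linarith) ?_
      refine (neg_log_one_sub_le (by linarith) (by linarith)).trans ?_
      have : (2 * (v * t)) ^ 2 / (2 * (1 - 2 * (v * t))) =
          2 * ((v * t) ^ 2 / (1 - 2 * (v * t))) := by
        have : 1 - 2 * (v * t) ≠ 0 := by linarith
        field_simp
      linarith
    calc rexp (-t * (v * p + a)) * (√(1 - 2 * (v * t)))⁻¹ ^ p
        ≤ rexp (-t * (v * p + a)) * rexp (v * t + t ^ 2 / (1 - 2 * t)) ^ p := by gcongr
      _ = rexp (-t * a + p * (t ^ 2 / (1 - 2 * t))) := by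
        rw [← Real.exp_nat_mul, ← Real.exp_add]
        congr 1
        ring
      _ ≤ rexp (-x) := Real.exp_le_exp.2 ht
  have hlow : (noiseMeasure p n).real {ξ | sqnorm (colPi ξ i) ≤ v * p - a} ≤ rexp (-x) := by
    have hlt : 2 * ((1 - 1 / (n : ℝ)) * -t) < 1 := by
      rw [← hv]
      linarith
    refine (measure_le_le_exp_mul_mgf _ (neg_nonpos.2 ht0)
      (integrable_exp_mul_sqnorm_colPi i hlt)).trans ?_
    rw [mgf_sqnorm_colPi i hlt, ← hv]
    have hb : (√(1 - 2 * (v * -t)))⁻¹ ≤ rexp (-(v * t) + t ^ 2 / (1 - 2 * t)) := by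
      refine inv_sqrt_le_exp (by linarith) ?_
      have h := neg_log_one_add_le (u := 2 * (v * t)) (by linarith)
      rw [show 1 - 2 * (v * -t) = 1 + 2 * (v * t) by ring]
      nlinarith
    calc rexp (- -t * (v * p - a)) * (√(1 - 2 * (v * -t)))⁻¹ ^ p
        ≤ rexp (- -t * (v * p - a)) * rexp (-(v * t) + t ^ 2 / (1 - 2 * t)) ^ p := by gcongr
      _ = rexp (-t * a + p * (t ^ 2 / (1 - 2 * t))) := by
        rw [← Real.exp_nat_mul, ← Real.exp_add]
        congr 1
        ring
      _ ≤ rexp (-x) := Real.exp_le_exp.2 ht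
  rw [← hv]
  calc (noiseMeasure p n).real {ξ | a < |sqnorm (colPi ξ i) - v * p|}
      ≤ (noiseMeasure p n).real
          ({ξ | v * p + a ≤ sqnorm (colPi ξ i)} ∪ {ξ | sqnorm (colPi ξ i) ≤ v * p - a}) := by
        refine measureReal_mono fun ξ hξ => ?_
        rcases lt_abs.1 (Set.mem_ofPred_eq ▸ hξ) with h | h
        · exact Or.inl (show v * p + a ≤ sqnorm (colPi ξ i) by linarith)
        · exact Or.inr (show sqnorm (colPi ξ i) ≤ v * p - a by linarith)
    _ ≤ _ := measureReal_union_le _ _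
    _ ≤ 2 * rexp (-x) := by linarith

lemma sqnorm_nonneg {p : ℕ} (v : Fin p → ℝ) : 0 ≤ sqnorm v :=
  Finset.sum_nonneg fun _ _ => sq_nonneg _

/-- The triangle inequality for the Euclidean norm, in squared form. -/
lemma sqnorm_add_smul_le {p : ℕ} (u w : Fin p → ℝ) {σ : ℝ} (hσ : 0 ≤ σ) :
    sqnorm (u + σ • w) ≤ sqnorm u + 2 * σ * (√(sqnorm u) * √(sqnorm w)) + σ ^ 2 * sqnorm w := by
  have h := mul_le_mul_of_nonneg_left
    (Real.sum_mul_le_sqrt_mul_sqrt Finset.univ u w) (show 0 ≤ 2 * σ by positivity)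
  have hexp : sqnorm (u + σ • w) =
      sqnorm u + 2 * σ * ∑ k, u k * w k + σ ^ 2 * sqnorm w := by
    simp only [sqnorm, Pi.add_apply, Pi.smul_apply, smul_eq_mul, Finset.mul_sum,
      ← Finset.sum_add_distrib]
    refine Finset.sum_congr rfl fun k _ => ?_
    ring
  rw [hexp]
  unfold sqnorm
  linarith

/-- A column with no contamination equals the estimation error of `L_n` plus centred noise. -/
lemma colPi_Ymat_add {p n : ℕ} (μ : Fin p → ℝ) (Θ ξ : Fin n → Fin p → ℝ) (σ : ℝ)
    (L : Fin p → ℝ) {i : Fin n} (hi : Θ i = 0) :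
    colPi (Ymat μ Θ σ ξ) i + L = (L - LnFun Θ) + σ • colPi ξ i := by
  have hn : (n : ℝ) ≠ 0 := by exact_mod_cast (Fin.pos i).ne'
  ext k
  simp only [colPi, Ymat, LnFun, hi, Pi.add_apply, Pi.sub_apply, Pi.smul_apply, smul_eq_mul,
    Finset.sum_apply, Finset.sum_add_distrib, Finset.sum_const, Finset.card_univ,
    Fintype.card_fin, nsmul_eq_mul, Pi.zero_apply, Pi.mul_apply, Pi.natCast_apply, ← Finset.mul_sum]
  field_simp
  ring

lemma sq_add_mul_add_le {q g σ d b v : ℝ} (hq : 0 ≤ q) (hg : 0 < g) (hσ : 0 < σ)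
    (hd0 : 0 ≤ d) (hb0 : 0 ≤ b) (hv : v ≤ 1) (hd : d < σ * g ^ 2 / (4 * √(q + g ^ 2)))
    (hb : b ^ 2 ≤ v * q + g ^ 2 / 2) :
    d ^ 2 + 2 * σ * (d * b) + σ ^ 2 * b ^ 2 ≤ v * σ ^ 2 * q + (σ * g) ^ 2 := by
  obtain ⟨R, hR, hR2⟩ : ∃ R, 0 < R ∧ R ^ 2 = q + g ^ 2 :=
    ⟨√(q + g ^ 2), Real.sqrt_pos.2 (by positivity), Real.sq_sqrt (by positivity)⟩
  rw [← hR2, Real.sqrt_sq hR.le] at hd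
  have hbR : b ≤ R - g ^ 2 / (4 * R) := by
    have h0 : 0 ≤ R - g ^ 2 / (4 * R) := by
      rw [sub_nonneg, div_le_iff₀ (by positivity)]
      nlinarith
    refine abs_le_of_sq_le_sq' ?_ h0 |>.2
    have : (R - g ^ 2 / (4 * R)) ^ 2 = R ^ 2 - g ^ 2 / 2 + (g ^ 2 / (4 * R)) ^ 2 := by
      field_simp
      ring
    rw [this, hR2]
    nlinarith [sq_nonneg (g ^ 2 / (4 * R)), mul_le_of_le_one_left hq hv]
  obtain ⟨e, he⟩ : ∃ e, e = g ^ 2 / (4 * R) := ⟨_, rfl⟩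
  have he0 : 0 ≤ e := by
    rw [he]
    positivity
  have heR : 4 * (e * R) = g ^ 2 := by
    rw [he]
    field_simp
  have hd' : d ≤ σ * e := by
    rw [he, mul_div_assoc']
    exact hd.le
  rw [← he] at hbR
  have h1 : d ^ 2 ≤ (σ * e) ^ 2 := by gcongr
  have h2 : d * b ≤ σ * e * (R - e) := by gcongr
  have h3 : σ ^ 2 * b ^ 2 ≤ σ ^ 2 * (v * q + g ^ 2 / 2) := by gcongr
  nlinarith [mul_le_mul_of_nonneg_left h2 (show 0 ≤ 2 * σ by positivity), sq_nonneg (σ * e)]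

/-- Lemma 5.1: with `Z_i = (YΠ)_i + L̃_n` and `w_i` the soft-thresholding weights,
(i) on the event `Ω₁ ∩ Ω₂` (with `Ω₁ = {‖L̃_n - L_n(Θ)‖₂ < σγ²/(4√(p+γ²))}` and
`Ω₂ = {max_i |‖ξ̄_i‖₂² - (1-1/n)p| ≤ 0.5γ²}`, `ξ̄_i = ξ_i - ξ̄`), `w_i = 0` for every `i ∉ S`;
(ii) if `γ² > 4 log(4n/δ) + 4 (p log(4n/δ))^{1/2}` then `P(Ω₂) ≥ 1 - δ/2`. -/
theorem weights_vanish_off_support (p n s : ℕ) (σ δ γ : ℝ) (hσ : 0 < σ) (hγ : 0 < γ)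
    (hδ : δ ∈ Set.Ioo (0 : ℝ) 1) (μ : Fin p → ℝ) (Θ : Fin n → Fin p → ℝ) :
    (∀ (ξ : Fin n → Fin p → ℝ) (Ltilde : Fin p → ℝ),
      Real.sqrt (sqnorm (Ltilde - LnFun Θ)) < σ * γ ^ 2 / (4 * Real.sqrt (p + γ ^ 2)) →
      (∀ i, |sqnorm (colPi ξ i) - (1 - 1 / (n : ℝ)) * p| ≤ 0.5 * γ ^ 2) →
      ∀ i, Θ i = 0 →
        istWeight p n σ γ (colPi (Ymat μ Θ σ ξ) i + Ltilde) = 0) ∧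
    (4 * Real.log (4 * n / δ) + 4 * Real.sqrt (p * Real.log (4 * n / δ)) < γ ^ 2 →
      ENNReal.ofReal (1 - δ / 2) ≤
        noiseMeasure p n
          {ξ | ∀ i, |sqnorm (colPi ξ i) - (1 - 1 / (n : ℝ)) * p| ≤ 0.5 * γ ^ 2}) := by
  refine ⟨fun ξ L hL hξ i hi => ?_, fun hγ' => ?_⟩
  · have hn : (n : ℝ) ≠ 0 := by exact_mod_cast (Fin.pos i).ne'
    have hfrac : ((n : ℝ) - 1) / n = 1 - 1 / n := by field_simp
    have hv : 1 - 1 / (n : ℝ) ≤ 1 := by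
      have : 0 ≤ 1 / (n : ℝ) := by positivity
      linarith
    have hb : √(sqnorm (colPi ξ i)) ^ 2 ≤ (1 - 1 / (n : ℝ)) * p + γ ^ 2 / 2 := by
      rw [Real.sq_sqrt (sqnorm_nonneg _)]
      linarith [(abs_le.1 (hξ i)).2]
    have hmain := sq_add_mul_add_le (Nat.cast_nonneg p) hγ hσ (Real.sqrt_nonneg _)
      (Real.sqrt_nonneg _) hv hL hb
    rw [Real.sq_sqrt (sqnorm_nonneg _), Real.sq_sqrt (sqnorm_nonneg _)] at hmain
    have hle := (sqnorm_add_smul_le (L - LnFun Θ) (colPi ξ i) hσ.le).trans hmain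
    rw [colPi_Ymat_add μ Θ ξ σ L hi, istWeight, hfrac]
    split_ifs with hpos
    · refine max_eq_right ?_
      rw [sub_nonpos, one_le_div (Real.sqrt_pos.2 (by linarith))]
      exact Real.sqrt_le_iff.2 ⟨by positivity, by linarith⟩
    · rfl
  · obtain ⟨hδ0, hδ1⟩ := hδ
    obtain ⟨x, hx⟩ : ∃ x, x = Real.log (4 * n / δ) := ⟨_, rfl⟩
    rw [← hx] at hγ'
    let B : Fin n → Set (Fin n → Fin p → ℝ) := fun i =>
      {ξ | 0.5 * γ ^ 2 < |sqnorm (colPi ξ i) - (1 - 1 / (n : ℝ)) * p|}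
    have hB (i : Fin n) : (noiseMeasure p n).real (B i) ≤ δ / (2 * n) := by
      have hn : (1 : ℝ) ≤ n := by exact_mod_cast Fin.pos i
      have hlt : 1 < 4 * n / δ := by
        rw [one_lt_div hδ0]
        linarith
      have hx0 : 0 < x := hx ▸ Real.log_pos hlt
      refine (noiseMeasure_real_deviation_le i hx0 (by linarith)).trans_eq ?_
      rw [Real.exp_neg, hx, Real.exp_log (by linarith)]
      field_simp
      norm_num
    have hmeas (i : Fin n) : MeasurableSet (B i) :=
      measurableSet_lt measurable_const
        (continuous_abs.measurable.comp ((measurable_sqnorm_colPi i).sub_const _))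
    have hset : {ξ : Fin n → Fin p → ℝ |
        ∀ i, |sqnorm (colPi ξ i) - (1 - 1 / (n : ℝ)) * p| ≤ 0.5 * γ ^ 2} = (⋃ i, B i)ᶜ := by
      ext ξ
      simp [B]
    have hsum : (noiseMeasure p n).real (⋃ i, B i) ≤ δ / 2 := by
      refine (measureReal_iUnion_fintype_le B).trans ((Finset.sum_le_sum fun i _ => hB i).trans ?_)
      rw [Finset.sum_const, Finset.card_univ, Fintype.card_fin, nsmul_eq_mul]
      rcases Nat.eq_zero_or_pos n with rfl | hn
      · simp only [CharP.cast_eq_zero, zero_mul]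
        positivity
      · have : (0 : ℝ) < n := by exact_mod_cast hn
        refine le_of_eq ?_
        field_simp
    rw [hset, ← ofReal_measureReal, probReal_compl_eq_one_sub (MeasurableSet.iUnion hmeas)]
    exact ENNReal.ofReal_le_ofReal (by linarith)
end
end

section
/- If η is a random variable drawn from the chi-squared distribution χ²_d with d degrees of freedom, then for every x > 0: P(η ≥ d + x) ≤ exp( −x·(x ∧ 4d)/(16d) ). -/
open MeasureTheory ProbabilityTheory

theorem two_mul_log_le_sub_inv {y : ℝ} (hy : 1 ≤ y) : 2 * Real.log y ≤ y - y⁻¹ := by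
  have h := Real.self_le_sinh_iff.2 (Real.log_nonneg hy)
  rw [Real.sinh_log (by linarith)] at h
  linarith

theorem log_one_add_le_sub_sq_div_eight {u : ℝ} (hu : 0 ≤ u) (hu4 : u ≤ 4) :
    Real.log (1 + u) ≤ u - u ^ 2 / 8 := by
  set y := √(1 + u) with hy
  have hy2 : y ^ 2 = 1 + u := Real.sq_sqrt (by linarith)
  have hy1 : 1 ≤ y := Real.one_le_sqrt.2 (by linarith)
  have hy3 : y ≤ 3 := by nlinarith
  have hlog := two_mul_log_le_sub_inv hy1
  have hu' : u = y ^ 2 - 1 := by linarith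
  have hmul : 0 ≤ (y - 1) * (8 - y - y ^ 2) := mul_nonneg (by linarith) (by nlinarith)
  have hinv : y - y⁻¹ ≤ u - u ^ 2 / 8 := by
    have hfac : u - u ^ 2 / 8 - (y - y⁻¹) =
        (y ^ 2 - 1) * ((y - 1) * (8 - y - y ^ 2)) / (8 * y) := by
      rw [hu']
      field_simp
      ring
    have : 0 ≤ (y ^ 2 - 1) * ((y - 1) * (8 - y - y ^ 2)) / (8 * y) :=
      div_nonneg (mul_nonneg (by nlinarith) hmul) (by linarith)
    linarith
  have : Real.log (1 + u) = 2 * Real.log y := by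
    rw [← hy2, Real.log_pow]
    norm_num
  linarith

theorem log_one_add_le_sub_mul_min {u : ℝ} (hu : 0 ≤ u) :
    Real.log (1 + u) ≤ u - u * min u 4 / 8 := by
  rcases le_total u 4 with h | h
  · rw [min_eq_left h, ← sq]
    exact log_one_add_le_sub_sq_div_eight hu h
  · rw [min_eq_right h]
    have h5 : Real.log 5 ≤ 2 := by
      have := log_one_add_le_sub_sq_div_eight (u := 4) (by norm_num) le_rfl
      norm_num at this
      exact this
    have hdiv := Real.log_le_sub_one_of_pos (x := (1 + u) / 5) (by linarith)
    rw [Real.log_div (by linarith) (by norm_num)] at hdiv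
    linarith

/-- The moment generating function of `χ²₁`, parametrised by `t = u / (2 (1 + u))`. -/
theorem integral_exp_mul_sq_gaussianReal {u : ℝ} (hu : 0 ≤ u) :
    ∫ z, Real.exp (u / (2 * (1 + u)) * z ^ 2) ∂(gaussianReal 0 1) = √(1 + u) := by
  have hu1 : 0 < 1 + u := by linarith
  rw [integral_gaussianReal_eq_integral_smul one_ne_zero]
  have hexp : ∀ z : ℝ, gaussianPDFReal 0 1 z • Real.exp (u / (2 * (1 + u)) * z ^ 2) =
      (√(2 * Real.pi))⁻¹ * Real.exp (-(1 / (2 * (1 + u))) * z ^ 2) := by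
    intro z
    simp only [gaussianPDFReal, NNReal.coe_one, mul_one, sub_zero, smul_eq_mul]
    rw [mul_assoc, ← Real.exp_add]
    congr 2
    field_simp
    ring
  simp_rw [hexp]
  rw [integral_const_mul, integral_gaussian, ← Real.sqrt_inv, ← Real.sqrt_mul (by positivity)]
  congr 1
  have := Real.pi_pos
  field_simp

theorem mgf_sum_sq_pi_gaussianReal {ι : Type*} [Fintype ι] {u : ℝ} (hu : 0 ≤ u) :
    mgf (fun ζ : ι → ℝ => ∑ i, (ζ i) ^ 2) (Measure.pi fun _ => gaussianReal 0 1)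
      (u / (2 * (1 + u))) = √(1 + u) ^ Fintype.card ι := by
  simp_rw [mgf, Finset.mul_sum, Real.exp_sum]
  rw [integral_fintype_prod_eq_prod (f := fun _ z => Real.exp (u / (2 * (1 + u)) * z ^ 2))]
  simp [integral_exp_mul_sq_gaussianReal hu]

/-- Lemma 6.2 (chi-squared tail bound): if `η ∼ χ²_d`, i.e. `η = ‖ζ‖₂²` with `ζ ∼ N(0, I_d)`,
then for every `x > 0`, `P(η ≥ d + x) ≤ exp(-x (x ∧ 4d)/(16d))`. -/
theorem chi_squared_tail (d : ℕ) (hd : 1 ≤ d) (x : ℝ) (hx : 0 < x) :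
    (Measure.pi fun _ : Fin d => gaussianReal 0 1)
        {ζ | (d : ℝ) + x ≤ ∑ i, (ζ i) ^ 2} ≤
      ENNReal.ofReal (Real.exp (-(x * min x (4 * d)) / (16 * d))) := by
  have hd0 : (0 : ℝ) < d := by exact_mod_cast hd
  obtain ⟨u, rfl⟩ : ∃ u : ℝ, x = d * u := ⟨x / d, by field_simp⟩
  have hu : 0 < u := pos_of_mul_pos_right hx hd0.le
  have hu1 : 0 < 1 + u := by linarith
  have hmgf := mgf_sum_sq_pi_gaussianReal (ι := Fin d) hu.le
  rw [Fintype.card_fin] at hmgf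
  have hint : Integrable (fun ζ : Fin d → ℝ =>
      Real.exp (u / (2 * (1 + u)) * ∑ i, (ζ i) ^ 2)) (Measure.pi fun _ => gaussianReal 0 1) := by
    refine Integrable.of_integral_ne_zero ?_
    rw [← mgf, hmgf]
    positivity
  have hchernoff := measure_ge_le_exp_mul_mgf (d + d * u) (by positivity) hint
  rw [hmgf] at hchernoff
  rw [← ofReal_measureReal]
  refine ENNReal.ofReal_le_ofReal (hchernoff.trans ?_)
  have hsqrt : √(1 + u) ^ d = Real.exp (d * (Real.log (1 + u) / 2)) := by
    rw [← Real.log_sqrt hu1.le, Real.exp_nat_mul, Real.exp_log (by positivity)]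
  rw [hsqrt, ← Real.exp_add, Real.exp_le_exp]
  have hmin : min (d * u) (4 * (d : ℝ)) = d * min u 4 := by
    rw [mul_comm 4, mul_min_of_nonneg _ _ hd0.le]
  have hleft : -(u / (2 * (1 + u))) * (d + d * u) = d * (-u / 2) := by
    field_simp
  have hright : -(d * u * (d * min u 4)) / (16 * (d : ℝ)) = d * (-(u * min u 4) / 16) := by
    field_simp
  rw [hmin, hleft, hright, ← mul_add]
  refine mul_le_mul_of_nonneg_left ?_ hd0.le
  have := log_one_add_le_sub_mul_min hu.le
  linarith
end

section
/- If η is a random variable drawn from the chi-squared distribution χ²_d with d degrees of freedom, then for every x > 0 and every d ≥ 2: E[η·1{η ≥ d + x}] ≤ 2d·e^{−x²/(32d)}·1{x < 4d} + 2x·e^{−x/4}·1{x ≥ 4d}. -/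
open MeasureTheory ProbabilityTheory

/-- Exponentially tilting the standard Gaussian density by `exp (l * y ^ 2)` gives a multiple of the
centred Gaussian density with variance `v = (1 - 2 * l)⁻¹`. -/
lemma gaussianPDFReal_mul_exp_sq {l : ℝ} {v : NNReal} (hv : (v : ℝ) * (1 - 2 * l) = 1) (y : ℝ) :
    gaussianPDFReal 0 1 y * Real.exp (l * y ^ 2) = √(v : ℝ) * gaussianPDFReal 0 v y := by
  have hv0 : (v : ℝ) ≠ 0 := by rintro h; simp [h] at hv
  have hl : l = (1 - (v : ℝ)⁻¹) / 2 := by field_simp; linarith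
  have hs : √(v : ℝ) ≠ 0 := by
    rw [Real.sqrt_ne_zero']; exact lt_of_le_of_ne v.2 hv0.symm
  have he : Real.exp (-y ^ 2 / (2 * v)) = Real.exp (-y ^ 2 / 2) * Real.exp (l * y ^ 2) := by
    rw [← Real.exp_add, hl]; congr 1; field_simp; ring
  have hs2 : √(2 * Real.pi * v) = √(2 * Real.pi) * √(v : ℝ) := Real.sqrt_mul (by positivity) _
  simp only [gaussianPDFReal, sub_zero, NNReal.coe_one, mul_one, he, hs2]
  field_simp

lemma lintegral_gaussianReal_mul_exp_sq {l : ℝ} {v : NNReal} (hv : (v : ℝ) * (1 - 2 * l) = 1)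
    {f : ℝ → ENNReal} (hf : Measurable f) :
    ∫⁻ y, f y * ENNReal.ofReal (Real.exp (l * y ^ 2)) ∂gaussianReal 0 1 =
      ENNReal.ofReal √(v : ℝ) * ∫⁻ y, f y ∂gaussianReal 0 v := by
  have hv0 : v ≠ 0 := by rintro rfl; simp at hv
  rw [gaussianReal_of_var_ne_zero _ one_ne_zero, gaussianReal_of_var_ne_zero _ hv0,
    lintegral_withDensity_eq_lintegral_mul _ (measurable_gaussianPDF _ _) (by fun_prop),
    lintegral_withDensity_eq_lintegral_mul _ (measurable_gaussianPDF _ _) hf,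
    ← lintegral_const_mul _ ((measurable_gaussianPDF _ _).mul hf)]
  refine lintegral_congr fun y => ?_
  have h : gaussianPDF 0 1 y * ENNReal.ofReal (Real.exp (l * y ^ 2)) =
      ENNReal.ofReal √(v : ℝ) * gaussianPDF 0 v y := by
    rw [gaussianPDF, gaussianPDF, ← ENNReal.ofReal_mul (gaussianPDFReal_nonneg _ _ _),
      ← ENNReal.ofReal_mul (Real.sqrt_nonneg _), gaussianPDFReal_mul_exp_sq hv]
  simp only [Pi.mul_apply]
  rw [mul_left_comm, h]
  ring

lemma lintegral_sq_gaussianReal_zero (v : NNReal) :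
    ∫⁻ y, ENNReal.ofReal (y ^ 2) ∂gaussianReal 0 v = v := by
  have h := ofReal_variance (memLp_id_gaussianReal (μ := 0) (v := v) 2)
  rw [variance_id_gaussianReal, evariance_eq_lintegral_ofReal] at h
  simpa [integral_id_gaussianReal] using h.symm

/-- The expectation of `η * exp (l * η)` for a chi-squared variable `η` with `d` degrees of freedom,
where `v = (1 - 2 * l)⁻¹`. -/
lemma lintegral_sum_sq_mul_exp {d : ℕ} {l : ℝ} {v : NNReal} (hv : (v : ℝ) * (1 - 2 * l) = 1) :
    ∫⁻ ζ, ENNReal.ofReal ((∑ i, (ζ i) ^ 2) * Real.exp (l * ∑ i, (ζ i) ^ 2))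
      ∂(Measure.pi fun _ : Fin d => gaussianReal 0 1) =
      ENNReal.ofReal (d * v * √(v : ℝ) ^ d) := by
  let g : Fin d → Fin d → ℝ → ENNReal := fun i j y =>
    (if j = i then ENNReal.ofReal (y ^ 2) else 1) * ENNReal.ofReal (Real.exp (l * y ^ 2))
  have hm : ∀ i j : Fin d,
      Measurable fun y : ℝ => if j = i then ENNReal.ofReal (y ^ 2) else (1 : ENNReal) := by
    intro i j; split_ifs <;> fun_prop
  have hg : ∀ i j, Measurable (g i j) := fun i j => (hm i j).mul (by fun_prop)
  have hpt : ∀ ζ : Fin d → ℝ,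
      ENNReal.ofReal ((∑ i, (ζ i) ^ 2) * Real.exp (l * ∑ i, (ζ i) ^ 2)) =
        ∑ i, ∏ j, g i j (ζ j) := by
    intro ζ
    simp only [g, Finset.prod_mul_distrib, Finset.prod_ite_eq', Finset.mem_univ, if_true]
    rw [← Finset.sum_mul, ENNReal.ofReal_mul (by positivity), Finset.mul_sum, Real.exp_sum,
      ENNReal.ofReal_prod_of_nonneg (fun _ _ => (Real.exp_pos _).le),
      ENNReal.ofReal_sum_of_nonneg (fun _ _ => sq_nonneg _)]
  have hint : ∀ i j, ∫⁻ y, g i j y ∂gaussianReal 0 1 =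
      (if j = i then (v : ENNReal) else 1) * ENNReal.ofReal √(v : ℝ) := by
    intro i j
    rw [lintegral_gaussianReal_mul_exp_sq hv (hm i j), mul_comm]
    split_ifs
    · rw [lintegral_sq_gaussianReal_zero]
    · simp
  have hprod : ∀ i, ∫⁻ ζ, ∏ j, g i j (ζ j) ∂(Measure.pi fun _ : Fin d => gaussianReal 0 1) =
      v * ENNReal.ofReal √(v : ℝ) ^ d := by
    intro i
    rw [lintegral_prod_eq_prod_lintegral_of_indepFun Finset.univ
      (fun j (ζ : Fin d → ℝ) => g i j (ζ j))
      (iIndepFun_pi fun j => (hg i j).aemeasurable)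
      (fun j => (hg i j).comp (measurable_pi_apply j))]
    simp_rw [fun j => (measurePreserving_eval (fun _ : Fin d => gaussianReal 0 1) j).lintegral_comp
      (hg i j), hint]
    rw [Finset.prod_mul_distrib, Finset.prod_ite_eq']
    simp
  simp_rw [hpt]
  rw [lintegral_finsetSum]
  swap
  · exact fun i _ => Finset.measurable_fun_prod _ fun j _ =>
      (hg i j).comp (measurable_pi_apply j)
  simp_rw [hprod]
  rw [ENNReal.ofReal_mul (by positivity), ENNReal.ofReal_mul (by positivity),
    ENNReal.ofReal_pow (by positivity)]
  simp [mul_assoc]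

/-- Chernoff bound for the truncated expectation of a chi-squared variable. -/
lemma setLIntegral_sum_sq_le {d : ℕ} {l a t : ℝ} {v : NNReal} (hl : 0 ≤ l)
    (hv : (v : ℝ) * (1 - 2 * l) = 1) (hva : (v : ℝ) ≤ Real.exp (2 * a)) :
    ∫⁻ ζ in {ζ | t ≤ ∑ i, (ζ i) ^ 2},
        ENNReal.ofReal (∑ i, (ζ i) ^ 2) ∂(Measure.pi fun _ : Fin d => gaussianReal 0 1) ≤
      ENNReal.ofReal (d * v * Real.exp (d * a - l * t)) := by
  have hs : √(v : ℝ) ^ d ≤ Real.exp (d * a) := by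
    rw [Real.exp_nat_mul]
    refine pow_le_pow_left₀ (Real.sqrt_nonneg _) (Real.sqrt_le_iff.2 ⟨by positivity, ?_⟩) d
    rwa [← Real.exp_nat_mul]
  have hS : MeasurableSet {ζ : Fin d → ℝ | t ≤ ∑ i, (ζ i) ^ 2} :=
    measurableSet_le (by fun_prop) (by fun_prop)
  calc _ ≤ ∫⁻ ζ in {ζ | t ≤ ∑ i, (ζ i) ^ 2}, ENNReal.ofReal (Real.exp (-(l * t))) *
          ENNReal.ofReal ((∑ i, (ζ i) ^ 2) * Real.exp (l * ∑ i, (ζ i) ^ 2))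
          ∂(Measure.pi fun _ : Fin d => gaussianReal 0 1) := by
        refine setLIntegral_mono' hS fun ζ hζ => ?_
        rw [← ENNReal.ofReal_mul (by positivity)]
        refine ENNReal.ofReal_le_ofReal ?_
        rw [mul_left_comm, ← Real.exp_add]
        refine le_mul_of_one_le_right (by positivity) (Real.one_le_exp ?_)
        have := mul_le_mul_of_nonneg_left (show t ≤ ∑ i, (ζ i) ^ 2 from hζ) hl
        linarith
    _ ≤ ∫⁻ ζ, ENNReal.ofReal (Real.exp (-(l * t))) *
          ENNReal.ofReal ((∑ i, (ζ i) ^ 2) * Real.exp (l * ∑ i, (ζ i) ^ 2))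
          ∂(Measure.pi fun _ : Fin d => gaussianReal 0 1) := setLIntegral_le_lintegral _ _
    _ = ENNReal.ofReal (Real.exp (-(l * t)) * (d * v * √(v : ℝ) ^ d)) := by
        rw [lintegral_const_mul _ (by fun_prop), lintegral_sum_sq_mul_exp hv,
          ← ENNReal.ofReal_mul (by positivity)]
    _ ≤ _ := by
        refine ENNReal.ofReal_le_ofReal ?_
        rw [sub_eq_add_neg, Real.exp_add, mul_comm, mul_assoc, mul_assoc, mul_assoc]
        gcongr

lemma one_le_one_sub_mul_exp {y : ℝ} (hy : 0 ≤ y) (hy' : y ≤ 1 / 2) :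
    1 ≤ (1 - y) * Real.exp (y + y ^ 2) := by
  have h := Real.quadratic_le_exp_of_nonneg (x := y + y ^ 2) (by positivity)
  have h2 := mul_le_mul_of_nonneg_left h (by linarith : 0 ≤ 1 - y)
  have h3 : y + y ^ 2 + y ^ 3 ≤ 1 := by
    have : y ^ 2 ≤ 1 / 4 := by nlinarith
    nlinarith
  nlinarith [mul_nonneg (sq_nonneg y) (sub_nonneg.2 h3)]

/-- Lemma 6.3 (truncated chi-squared expectation): if `η ∼ χ²_d`, i.e. `η = ‖ζ‖₂²` with
`ζ ∼ N(0, I_d)`, then for every `x > 0` and `d ≥ 2`,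
`E[η 1{η ≥ d + x}] ≤ 2d e^{-x²/(32d)} 1{x < 4d} + 2x e^{-x/4} 1{x ≥ 4d}`. -/
theorem chi_squared_truncated_expectation (d : ℕ) (hd : 2 ≤ d) (x : ℝ) (hx : 0 < x) :
    ∫⁻ ζ in {ζ | (d : ℝ) + x ≤ ∑ i, (ζ i) ^ 2},
        ENNReal.ofReal (∑ i, (ζ i) ^ 2) ∂(Measure.pi fun _ : Fin d => gaussianReal 0 1) ≤
      ENNReal.ofReal
        ((if x < 4 * d then 2 * d * Real.exp (-x ^ 2 / (32 * d)) else 0) +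
          (if 4 * (d : ℝ) ≤ x then 2 * x * Real.exp (-x / 4) else 0)) := by
  have hd0 : (0 : ℝ) < d := by exact_mod_cast (by omega : 0 < d)
  rcases lt_or_ge x (4 * d) with h | h
  · rw [if_pos h, if_neg h.not_ge, add_zero]
    obtain ⟨l, hl⟩ : ∃ l, l = x / (16 * d) := ⟨_, rfl⟩
    have hxl : x = 16 * d * l := by rw [hl]; field_simp
    have hl0 : 0 ≤ l := by rw [hl]; positivity
    have hl1 : l ≤ 1 / 4 := by rw [hl, div_le_iff₀ (by positivity)]; linarith
    have hpos : 0 < 1 - 2 * l := by linarith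
    have hv2 : (1 - 2 * l)⁻¹ ≤ 2 := by
      rw [inv_le_comm₀ hpos two_pos]; linarith
    refine (setLIntegral_sum_sq_le (l := l) (a := l + 2 * l ^ 2)
      (v := NNReal.mk (1 - 2 * l)⁻¹ (by positivity)) hl0 (inv_mul_cancel₀ hpos.ne') ?_).trans ?_
    · have := one_le_one_sub_mul_exp (y := 2 * l) (by positivity) (by linarith)
      rwa [NNReal.coe_mk, inv_le_iff_one_le_mul₀' hpos,
        show 2 * (l + 2 * l ^ 2) = 2 * l + (2 * l) ^ 2 by ring]
    · refine ENNReal.ofReal_le_ofReal ?_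
      rw [NNReal.coe_mk, mul_comm (2 : ℝ) (d : ℝ)]
      have he : d * (l + 2 * l ^ 2) - l * (d + x) ≤ -x ^ 2 / (32 * d) := by
        have : -x ^ 2 / (32 * d) = -8 * d * l ^ 2 := by rw [hxl]; field_simp; ring
        rw [this, hxl]
        nlinarith [mul_nonneg hd0.le (sq_nonneg l)]
      gcongr
  · rw [if_neg h.not_gt, if_pos h, zero_add]
    have h2 : (2 : ℝ) ≤ Real.exp (7 / 8) := by
      rw [← Real.log_le_iff_le_exp two_pos]; linarith [Real.log_two_lt_d9]
    refine (setLIntegral_sum_sq_le (l := 3 / 8) (a := 7 / 8) (v := 4) (by norm_num)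
      (by norm_num) ?_).trans ?_
    · have : Real.exp (2 * (7 / 8)) = Real.exp (7 / 8) ^ 2 := by rw [← Real.exp_nat_mul]; norm_num
      rw [this, NNReal.coe_ofNat]
      nlinarith
    · refine ENNReal.ofReal_le_ofReal ?_
      rw [NNReal.coe_ofNat]
      have he : (d : ℝ) * (7 / 8) - 3 / 8 * (d + x) ≤ -x / 4 := by linarith
      have hdx : (d : ℝ) * 4 ≤ 2 * x := by linarith
      gcongr
end

section
/- If A is an N×n random matrix with independent standard Gaussian N(0,1) entries, then the expected squared operator norm of A satisfies E[‖A‖²] ≤ 3N + 3n + 12. -/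
open MeasureTheory ProbabilityTheory

noncomputable section

/-- The operator (spectral) norm of an `N × n` real matrix, viewed as a linear map between
Euclidean spaces. -/
def opNorm {N n : ℕ} (A : Matrix (Fin N) (Fin n) ℝ) : ℝ :=
  ‖LinearMap.toContinuousLinearMap (Matrix.toEuclideanLin A)‖

open scoped NNReal ENNReal

/-- The Laplace transform of a quadratic polynomial under the standard Gaussian measure. -/
lemma lintegral_exp_quadratic_gaussianReal (c : ℝ) {β : ℝ} (hβ : 0 ≤ β) :
    ∫⁻ x, ENNReal.ofReal (Real.exp (c * x - β / 2 * x ^ 2)) ∂gaussianReal 0 1 =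
      ENNReal.ofReal ((√(1 + β))⁻¹ * Real.exp (c ^ 2 / (2 * (1 + β)))) := by
  have hpos : 0 < 1 + β := by linarith
  set w : ℝ≥0 := ⟨(1 + β)⁻¹, by positivity⟩
  have hwc : (w : ℝ) = (1 + β)⁻¹ := rfl
  have hw0 : w ≠ 0 := by
    rw [← NNReal.coe_ne_zero, hwc]; positivity
  have key : ∀ x, gaussianPDFReal 0 1 x * Real.exp (c * x - β / 2 * x ^ 2) =
      (√(1 + β))⁻¹ * Real.exp (c ^ 2 / (2 * (1 + β))) *
        gaussianPDFReal (c / (1 + β)) w x := by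
    intro x
    simp only [gaussianPDFReal, hwc, NNReal.coe_one, mul_one, sub_zero]
    rw [Real.sqrt_mul (by positivity : (0 : ℝ) ≤ 2 * Real.pi), Real.sqrt_inv, mul_inv, inv_inv,
      mul_assoc, ← Real.exp_add]
    have hs : √(1 + β) ≠ 0 := by positivity
    have : c ^ 2 / (2 * (1 + β)) + -(x - c / (1 + β)) ^ 2 / (2 * (1 + β)⁻¹) =
        -x ^ 2 / 2 + (c * x - β / 2 * x ^ 2) := by
      field_simp
      ring
    rw [← this, Real.exp_add]
    field_simp
  rw [gaussianReal_of_var_ne_zero _ one_ne_zero,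
    lintegral_withDensity_eq_lintegral_mul _ (measurable_gaussianPDF _ _) (by fun_prop)]
  calc _ = ∫⁻ x, ENNReal.ofReal ((√(1 + β))⁻¹ * Real.exp (c ^ 2 / (2 * (1 + β)))) *
          gaussianPDF (c / (1 + β)) w x := by
        refine lintegral_congr fun x => ?_
        rw [Pi.mul_apply, gaussianPDF, gaussianPDF,
          ← ENNReal.ofReal_mul (gaussianPDFReal_nonneg _ _ _), ← ENNReal.ofReal_mul (by positivity), key]
    _ = _ := by
        rw [lintegral_const_mul _ (measurable_gaussianPDF _ _), lintegral_gaussianPDF_eq_one _ hw0,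
          mul_one]

lemma lintegral_exp_mul_gaussianReal (c : ℝ) :
    ∫⁻ x, ENNReal.ofReal (Real.exp (c * x)) ∂gaussianReal 0 1 =
      ENNReal.ofReal (Real.exp (c ^ 2 / 2)) := by
  simpa using lintegral_exp_quadratic_gaussianReal c le_rfl

lemma half_exp_le_lintegral_exp_quadratic (c b : ℝ) {β : ℝ} (hβ : 0 ≤ β) :
    ENNReal.ofReal (Real.exp (c * b - β / 2 * (b ^ 2 + 1 / 4) + (3 / 8 - b ^ 2 / 2)) / 2) ≤
      ∫⁻ x, ENNReal.ofReal (Real.exp (c * x - β / 2 * x ^ 2)) ∂gaussianReal 0 1 := by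
  rw [lintegral_exp_quadratic_gaussianReal c hβ]
  apply ENNReal.ofReal_le_ofReal
  have hpos : 0 < 1 + β := by linarith
  have hsqrt : √(1 + β) ≤ 2 * Real.exp ((1 + β) / 8 - 1 / 2) := by
    rw [Real.sqrt_le_iff]
    refine ⟨by positivity, ?_⟩
    rw [mul_pow, ← Real.exp_nat_mul]
    have := Real.add_one_le_exp (((2 : ℕ) : ℝ) * ((1 + β) / 8 - 1 / 2))
    push_cast at this ⊢
    linarith
  have hsq : c * b - (1 + β) / 2 * b ^ 2 ≤ c ^ 2 / (2 * (1 + β)) := by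
    rw [le_div_iff₀ (by positivity)]
    nlinarith [sq_nonneg (c - (1 + β) * b)]
  have hinv : Real.exp (-((1 + β) / 8 - 1 / 2)) / 2 ≤ (√(1 + β))⁻¹ := by
    rw [Real.exp_neg, div_eq_mul_inv, ← mul_inv, mul_comm]
    exact inv_anti₀ (by positivity) hsqrt
  calc _ = Real.exp (-((1 + β) / 8 - 1 / 2)) / 2 * Real.exp (c * b - (1 + β) / 2 * b ^ 2) := by
        rw [div_mul_eq_mul_div (Real.exp _), ← Real.exp_add]
        congr 2
        ring
    _ ≤ _ := by gcongr

lemma lintegral_pi_prod {ι : Type*} [Fintype ι] {X : ι → Type*} [∀ i, MeasurableSpace (X i)]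
    (μ : ∀ i, Measure (X i)) [∀ i, IsProbabilityMeasure (μ i)]
    {f : ∀ i, X i → ℝ≥0∞} (hf : ∀ i, Measurable (f i)) :
    ∫⁻ x, ∏ i, f i (x i) ∂Measure.pi μ = ∏ i, ∫⁻ y, f i y ∂μ i := by
  rw [lintegral_prod_eq_prod_lintegral_of_indepFun Finset.univ (fun i (x : ∀ i, X i) => f i (x i))
    (iIndepFun_pi fun i => (hf i).aemeasurable)
    fun i => (hf i).comp (measurable_pi_apply i)]
  exact Finset.prod_congr rfl fun i _ => (measurePreserving_eval μ i).lintegral_comp (hf i)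

lemma ofReal_exp_sum {ι : Type*} (s : Finset ι) (f : ι → ℝ) :
    ENNReal.ofReal (Real.exp (∑ i ∈ s, f i)) = ∏ i ∈ s, ENNReal.ofReal (Real.exp (f i)) := by
  rw [Real.exp_sum, ENNReal.ofReal_prod_of_nonneg fun _ _ => (Real.exp_pos _).le]

/-- A lower bound for a Gaussian integral over `ι → ℝ`, obtained by concentrating the Gaussian
near a point `b` with `‖b‖² = 3/4 * card ι`. -/
lemma exp_le_lintegral_exp_quadratic_pi {ι : Type*} [Fintype ι] (c b : ι → ℝ) {β : ℝ}
    (hβ : 0 ≤ β) (hb : ∑ i, b i ^ 2 = 3 / 4 * Fintype.card ι) :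
    ENNReal.ofReal (Real.exp (∑ i, c i * b i - β / 2 * Fintype.card ι) / 2 ^ Fintype.card ι) ≤
      ∫⁻ x, ENNReal.ofReal (Real.exp (∑ i, c i * x i - β / 2 * ∑ i, x i ^ 2))
        ∂(Measure.pi fun _ : ι => gaussianReal 0 1) := by
  have hx : ∀ x : ι → ℝ, ENNReal.ofReal (Real.exp (∑ i, c i * x i - β / 2 * ∑ i, x i ^ 2)) =
      ∏ i, ENNReal.ofReal (Real.exp (c i * x i - β / 2 * x i ^ 2)) := by
    intro x
    rw [← ofReal_exp_sum, Finset.sum_sub_distrib, Finset.mul_sum]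
  have hsum : ∑ i, c i * b i - β / 2 * Fintype.card ι =
      ∑ i, (c i * b i - β / 2 * (b i ^ 2 + 1 / 4) + (3 / 8 - b i ^ 2 / 2)) := by
    simp only [Finset.sum_add_distrib, Finset.sum_sub_distrib, ← Finset.mul_sum, ← Finset.sum_div,
      hb, Finset.sum_const, Finset.card_univ, nsmul_eq_mul]
    ring
  simp_rw [hx]
  rw [lintegral_pi_prod _ (f := fun i y => ENNReal.ofReal (Real.exp (c i * y - β / 2 * y ^ 2)))
    fun i => by fun_prop]
  calc _ = ∏ i, ENNReal.ofReal
        (Real.exp (c i * b i - β / 2 * (b i ^ 2 + 1 / 4) + (3 / 8 - b i ^ 2 / 2)) / 2) := by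
        rw [← ENNReal.ofReal_prod_of_nonneg fun _ _ => by positivity, Finset.prod_div_distrib,
          ← Real.exp_sum, ← hsum]
        simp
    _ ≤ _ := Finset.prod_le_prod' fun i _ => half_exp_le_lintegral_exp_quadratic _ _ hβ

/-- Gaussian average over rank-one matrices of the density of the Gaussian matrix shifted by
`α * h gᵀ`. -/
def gaussianMixture {N n : ℕ} (α : ℝ) (A : Fin N → Fin n → ℝ) : ℝ≥0∞ :=
  ∫⁻ g, ∫⁻ h, ENNReal.ofReal (Real.exp (∑ i, (α * ∑ j, A i j * g j) * h i -
      (α ^ 2 * ∑ j, g j ^ 2) / 2 * ∑ i, h i ^ 2))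
    ∂(Measure.pi fun _ : Fin N => gaussianReal 0 1) ∂(Measure.pi fun _ : Fin n => gaussianReal 0 1)

lemma lintegral_gaussianMixture (N n : ℕ) (α : ℝ) :
    ∫⁻ A, gaussianMixture α A
      ∂(Measure.pi fun _ : Fin N => Measure.pi fun _ : Fin n => gaussianReal 0 1) = 1 := by
  have hone : ∀ (g : Fin n → ℝ) (h : Fin N → ℝ),
      ∫⁻ A, ENNReal.ofReal (Real.exp (∑ i, (α * ∑ j, A i j * g j) * h i -
          (α ^ 2 * ∑ j, g j ^ 2) / 2 * ∑ i, h i ^ 2))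
        ∂(Measure.pi fun _ : Fin N => Measure.pi fun _ : Fin n => gaussianReal 0 1) = 1 := by
    intro g h
    have hA : ∀ A : Fin N → Fin n → ℝ,
        ENNReal.ofReal (Real.exp (∑ i, (α * ∑ j, A i j * g j) * h i -
          (α ^ 2 * ∑ j, g j ^ 2) / 2 * ∑ i, h i ^ 2)) =
        ENNReal.ofReal (Real.exp (-(∑ i, ∑ j, (α * g j * h i) ^ 2 / 2))) *
          ∏ i, ∏ j, ENNReal.ofReal (Real.exp (α * g j * h i * A i j)) := by
      intro A
      simp_rw [← ofReal_exp_sum]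
      rw [← ENNReal.ofReal_mul (Real.exp_pos _).le, ← Real.exp_add]
      congr 2
      rw [sub_eq_add_neg, add_comm]
      congr 1
      · rw [Finset.mul_sum]
        congr 1
        refine Finset.sum_congr rfl fun i _ => ?_
        rw [Finset.mul_sum, Finset.sum_div, Finset.sum_mul]
        exact Finset.sum_congr rfl fun j _ => by ring
      · refine Finset.sum_congr rfl fun i _ => ?_
        rw [Finset.mul_sum, Finset.sum_mul]
        exact Finset.sum_congr rfl fun j _ => by ring
    simp_rw [hA]
    rw [lintegral_const_mul _ (by fun_prop),
      lintegral_pi_prod _ (f := fun i (y : Fin n → ℝ) =>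
        ∏ j, ENNReal.ofReal (Real.exp (α * g j * h i * y j))) fun i => by fun_prop]
    have hrow : ∀ i, ∫⁻ y : Fin n → ℝ, ∏ j, ENNReal.ofReal (Real.exp (α * g j * h i * y j))
        ∂(Measure.pi fun _ : Fin n => gaussianReal 0 1) =
        ENNReal.ofReal (Real.exp (∑ j, (α * g j * h i) ^ 2 / 2)) := by
      intro i
      rw [lintegral_pi_prod _ (f := fun j y => ENNReal.ofReal (Real.exp (α * g j * h i * y)))
        fun j => by fun_prop, ofReal_exp_sum]
      exact Finset.prod_congr rfl fun j _ => lintegral_exp_mul_gaussianReal _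
    simp_rw [hrow]
    rw [← ofReal_exp_sum, ← ENNReal.ofReal_mul (Real.exp_pos _).le, ← Real.exp_add,
      neg_add_cancel, Real.exp_zero, ENNReal.ofReal_one]
  unfold gaussianMixture
  rw [lintegral_lintegral_swap]
  · calc _ = ∫⁻ _ : Fin n → ℝ, 1 ∂(Measure.pi fun _ : Fin n => gaussianReal 0 1) := by
          refine lintegral_congr fun g => ?_
          rw [lintegral_lintegral_swap (Measurable.aemeasurable (by fun_prop))]
          simp_rw [hone]
          simp
      _ = 1 := by simp
  · apply Measurable.aemeasurable
    apply Measurable.lintegral_prod_right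
    fun_prop

lemma exp_le_gaussianMixture {N n : ℕ} (α : ℝ) (A : Fin N → Fin n → ℝ) {a : Fin n → ℝ}
    {b : Fin N → ℝ} (ha : ∑ j, a j ^ 2 = 3 / 4 * n) (hb : ∑ i, b i ^ 2 = 3 / 4 * N) :
    ENNReal.ofReal (Real.exp (α * ∑ i, (∑ j, A i j * a j) * b i - α ^ 2 / 2 * N * n) /
        2 ^ (N + n)) ≤ gaussianMixture α A := by
  calc _ = ENNReal.ofReal (((2 : ℝ) ^ N)⁻¹) * ENNReal.ofReal
        (Real.exp (∑ j, (α * ∑ i, A i j * b i) * a j - (α ^ 2 * N) / 2 * Fintype.card (Fin n)) /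
          2 ^ Fintype.card (Fin n)) := by
        have : ∑ j, (α * ∑ i, A i j * b i) * a j = α * ∑ i, (∑ j, A i j * a j) * b i := by
          simp_rw [Finset.mul_sum, Finset.sum_mul, Finset.mul_sum]
          rw [Finset.sum_comm]
          exact Finset.sum_congr rfl fun i _ => Finset.sum_congr rfl fun j _ => by ring
        rw [← ENNReal.ofReal_mul (by positivity), this, Fintype.card_fin, pow_add]
        congr 1
        rw [show α ^ 2 / 2 * N * n = α ^ 2 * N / 2 * n by ring]
        field_simp
    _ ≤ ENNReal.ofReal (((2 : ℝ) ^ N)⁻¹) * ∫⁻ g : Fin n → ℝ, ENNReal.ofReal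
          (Real.exp (∑ j, (α * ∑ i, A i j * b i) * g j - (α ^ 2 * N) / 2 * ∑ j, g j ^ 2))
        ∂(Measure.pi fun _ : Fin n => gaussianReal 0 1) := by
        gcongr
        exact exp_le_lintegral_exp_quadratic_pi _ a (by positivity) (by simpa using ha)
    _ ≤ _ := by
        rw [← lintegral_const_mul _ (by fun_prop)]
        refine lintegral_mono fun g => le_trans (le_of_eq ?_)
          (exp_le_lintegral_exp_quadratic_pi (fun i => α * ∑ j, A i j * g j) b
            (β := α ^ 2 * ∑ j, g j ^ 2) (by positivity) (by simpa using hb))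
        have : ∑ j, (α * ∑ i, A i j * b i) * g j = ∑ i, (α * ∑ j, A i j * g j) * b i := by
          simp_rw [Finset.mul_sum, Finset.sum_mul]
          rw [Finset.sum_comm]
          exact Finset.sum_congr rfl fun i _ => Finset.sum_congr rfl fun j _ => by ring
        rw [← ENNReal.ofReal_mul (by positivity), this, Fintype.card_fin, inv_mul_eq_div]
        congr 4
        ring

/-- A continuous linear map between nontrivial finite-dimensional inner product spaces attains its
norm as a bilinear form on unit vectors. -/
lemma exists_unit_inner_eq_opNorm {E F : Type*} [NormedAddCommGroup E] [InnerProductSpace ℝ E]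
    [FiniteDimensional ℝ E] [Nontrivial E] [NormedAddCommGroup F] [InnerProductSpace ℝ F]
    [Nontrivial F] (f : E →L[ℝ] F) :
    ∃ u v, ‖u‖ = 1 ∧ ‖v‖ = 1 ∧ inner ℝ v (f u) = ‖f‖ := by
  have : ProperSpace E := FiniteDimensional.proper ℝ E
  obtain ⟨u, hu, hmax⟩ := (isCompact_sphere (0 : E) 1).exists_isMaxOn
    (NormedSpace.sphere_nonempty.2 zero_le_one) f.continuous.norm.continuousOn
  have hu1 : ‖u‖ = 1 := by simpa using hu
  have hf : ‖f‖ = ‖f u‖ :=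
    le_antisymm (f.opNorm_le_of_unit_norm (norm_nonneg _) fun x hx => hmax (by simpa using hx))
      (f.unit_le_opNorm u hu1.le)
  by_cases h0 : f u = 0
  · obtain ⟨v, hv⟩ := exists_norm_eq F zero_le_one
    exact ⟨u, v, hu1, hv, by simp [hf, h0]⟩
  · have hn : ‖f u‖ ≠ 0 := norm_ne_zero_iff.2 h0
    refine ⟨u, ‖f u‖⁻¹ • f u, hu1, ?_, ?_⟩
    · rw [norm_smul, norm_inv, norm_norm, inv_mul_cancel₀ hn]
    · rw [real_inner_smul_left, real_inner_self_eq_norm_sq, hf]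
      field_simp

lemma exists_bilinear_eq_opNorm {N n : ℕ} (hN : N ≠ 0) (hn : n ≠ 0) (A : Fin N → Fin n → ℝ) :
    ∃ (u : Fin n → ℝ) (v : Fin N → ℝ), ∑ j, u j ^ 2 = 1 ∧ ∑ i, v i ^ 2 = 1 ∧
      ∑ i, (∑ j, A i j * u j) * v i = opNorm (Matrix.of A) := by
  have : NeZero N := ⟨hN⟩
  have : NeZero n := ⟨hn⟩
  obtain ⟨u, v, hu, hv, huv⟩ := exists_unit_inner_eq_opNorm
    (LinearMap.toContinuousLinearMap (Matrix.toEuclideanLin (Matrix.of A)))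
  refine ⟨u, v, ?_, ?_, ?_⟩
  · rw [← EuclideanSpace.real_norm_sq_eq, hu, one_pow]
  · rw [← EuclideanSpace.real_norm_sq_eq, hv, one_pow]
  · rw [opNorm, ← huv, PiLp.inner_apply]
    simp [Matrix.toLpLin_apply, Matrix.mulVec, dotProduct]

lemma exp_opNorm_le_gaussianMixture {N n : ℕ} (hN : N ≠ 0) (hn : n ≠ 0) (t : ℝ)
    (A : Fin N → Fin n → ℝ) :
    ENNReal.ofReal (Real.exp (t * (3 / 4 * opNorm (Matrix.of A)) - t ^ 2 / 2) / 2 ^ (N + n)) ≤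
      gaussianMixture (t / (√N * √n)) A := by
  obtain ⟨u, v, hu, hv, huv⟩ := exists_bilinear_eq_opNorm hN hn A
  have hN' : (0 : ℝ) < N := by positivity
  have hn' : (0 : ℝ) < n := by positivity
  have h34 : √(3 / 4 : ℝ) ^ 2 = 3 / 4 := Real.sq_sqrt (by norm_num)
  have hNs : √(N : ℝ) ^ 2 = N := Real.sq_sqrt hN'.le
  have hns : √(n : ℝ) ^ 2 = n := Real.sq_sqrt hn'.le
  refine le_trans (le_of_eq ?_) (exp_le_gaussianMixture (t / (√N * √n)) A
    (a := fun j => √(3 / 4) * √n * u j) (b := fun i => √(3 / 4) * √N * v i) ?_ ?_)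
  · congr 3
    have hsum : ∑ i, (∑ j, A i j * (√(3 / 4) * √n * u j)) * (√(3 / 4) * √N * v i) =
        √(3 / 4) ^ 2 * (√N * √n) * opNorm (Matrix.of A) := by
      rw [← huv, Finset.mul_sum]
      refine Finset.sum_congr rfl fun i _ => ?_
      rw [Finset.sum_mul, Finset.sum_mul, Finset.mul_sum]
      exact Finset.sum_congr rfl fun j _ => by ring
    have hsq : (t / (√N * √n)) ^ 2 / 2 * N * n = t ^ 2 / 2 := by
      rw [div_pow, mul_pow, hNs, hns]
      field_simp
    rw [hsum, hsq, h34]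
    have : √(N : ℝ) * √n ≠ 0 := by positivity
    field_simp
  · simp_rw [mul_pow, ← Finset.mul_sum, hu, h34, hns, mul_one]
  · simp_rw [mul_pow, ← Finset.mul_sum, hv, h34, hNs, mul_one]

lemma sq_le_sq_add_exp {t z : ℝ} (ht : 1 ≤ t) (hz : 0 ≤ z) :
    z ^ 2 ≤ t ^ 2 + 2 * Real.exp (t * z - t ^ 2) := by
  rcases le_total z t with h | h
  · have := Real.exp_pos (t * z - t ^ 2)
    nlinarith
  · have hs : 0 ≤ t * z - t ^ 2 := by nlinarith
    have hq := Real.quadratic_le_exp_of_nonneg hs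
    have hw : (z - t) ^ 2 ≤ (t * z - t ^ 2) ^ 2 := by
      have : z - t ≤ t * z - t ^ 2 := by nlinarith
      have h0 : 0 ≤ z - t := by linarith
      gcongr
    nlinarith

lemma opNorm_sq_le_gaussianMixture {N n : ℕ} (hN : N ≠ 0) (hn : n ≠ 0) {t : ℝ}
    (ht : t ^ 2 = 7 / 5 * (N + n)) (ht1 : 1 ≤ t) (A : Fin N → Fin n → ℝ) :
    ENNReal.ofReal (opNorm (Matrix.of A) ^ 2) ≤
      ENNReal.ofReal (16 / 9 * t ^ 2) +
        ENNReal.ofReal (32 / 9) * gaussianMixture (t / (√N * √n)) A := by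
  refine le_trans ?_ (add_le_add_right (mul_le_mul_right (exp_opNorm_le_gaussianMixture hN hn t A)
    (ENNReal.ofReal (32 / 9))) _)
  rw [← ENNReal.ofReal_mul (by norm_num), ← ENNReal.ofReal_add (by positivity) (by positivity)]
  apply ENNReal.ofReal_le_ofReal
  have hA : 0 ≤ opNorm (Matrix.of A) := norm_nonneg _
  have hsq := sq_le_sq_add_exp ht1 (z := 3 / 4 * opNorm (Matrix.of A)) (by positivity)
  have h2 : (2 : ℝ) ^ (N + n) ≤ Real.exp (t ^ 2 / 2) := by
    rw [← Real.exp_log (by positivity : (0 : ℝ) < 2 ^ (N + n)), Real.log_pow, ht]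
    apply Real.exp_le_exp.2
    have hlog := Real.log_two_lt_d9
    have : (0 : ℝ) ≤ N + n := by positivity
    push_cast
    nlinarith
  have hexp : Real.exp (t * (3 / 4 * opNorm (Matrix.of A)) - t ^ 2) ≤
      Real.exp (t * (3 / 4 * opNorm (Matrix.of A)) - t ^ 2 / 2) / 2 ^ (N + n) := by
    rw [le_div_iff₀ (by positivity)]
    calc _ ≤ Real.exp (t * (3 / 4 * opNorm (Matrix.of A)) - t ^ 2) * Real.exp (t ^ 2 / 2) := by
          gcongr
      _ = _ := by
          rw [← Real.exp_add]
          congr 1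
          ring
  linarith

lemma opNorm_eq_zero_of_eq_zero {N n : ℕ} (h : N = 0 ∨ n = 0) (A : Matrix (Fin N) (Fin n) ℝ) :
    opNorm A = 0 := by
  have hA : A = 0 := by
    rcases h with rfl | rfl <;> exact Subsingleton.elim _ _
  simp [opNorm, hA]

/-- Lemma 6.6: if `A` is an `N × n` random matrix with independent standard Gaussian entries,
then `E[‖A‖²] ≤ 3N + 3n + 12`, where `‖A‖` is the operator norm. -/
theorem expected_sq_opnorm_gaussian (N n : ℕ) :
    ∫⁻ A, ENNReal.ofReal (opNorm (Matrix.of A) ^ 2)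
        ∂(Measure.pi fun _ : Fin N => Measure.pi fun _ : Fin n => gaussianReal 0 1) ≤
      ENNReal.ofReal (3 * N + 3 * n + 12) := by
  by_cases h : N = 0 ∨ n = 0
  · simp [opNorm_eq_zero_of_eq_zero h]
  obtain ⟨hN, hn⟩ := not_or.1 h
  have hN1 : (1 : ℝ) ≤ N := by exact_mod_cast Nat.one_le_iff_ne_zero.2 hN
  have hn1 : (1 : ℝ) ≤ n := by exact_mod_cast Nat.one_le_iff_ne_zero.2 hn
  set t : ℝ := √(7 / 5 * (N + n))
  have ht : t ^ 2 = 7 / 5 * (N + n) := Real.sq_sqrt (by positivity)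
  have ht1 : 1 ≤ t := Real.one_le_sqrt.2 (by linarith)
  calc _ ≤ ∫⁻ A, (ENNReal.ofReal (16 / 9 * t ^ 2) +
          ENNReal.ofReal (32 / 9) * gaussianMixture (t / (√N * √n)) A)
        ∂(Measure.pi fun _ : Fin N => Measure.pi fun _ : Fin n => gaussianReal 0 1) :=
        lintegral_mono fun A => opNorm_sq_le_gaussianMixture hN hn ht ht1 A
    _ = ENNReal.ofReal (16 / 9 * t ^ 2 + 32 / 9) := by
        rw [lintegral_add_left measurable_const, lintegral_const_mul' _ _ ENNReal.ofReal_ne_top,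
          lintegral_gaussianMixture, lintegral_const, measure_univ, mul_one, mul_one,
          ← ENNReal.ofReal_add (by positivity) (by norm_num)]
    _ ≤ _ := by
        apply ENNReal.ofReal_le_ofReal
        rw [ht]
        linarith
end
end
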